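/- arXiv:1809.01207 — 2 statements merged into one kernel-verified Lean document; each statement's English description precedes it below -/
import Mathlib

section
/- There exist universal constants h₁, h₂ > 0 such that the following holds. Let t, ℓ, a, r be positive integers with ℓ even, aℓ > h₁·√(t·r), and √r ≥ (t−1)·ℓ·2^{h₂·t}, and let y ∈ {±1}^{r − aℓ} be a perfectly balanced string (equal numbers of +1 and −1 entries). Then there is a probability distribution κ on {±1}^{aℓ}, supported on strings whose number of +1 entries is a multiple of ℓ/2, such that if x ∈ {±1}^r is sampled by drawing z ∼ κ, concatenating z with y, and applying a uniformly random permutation of the r coordinates, then for every subset S ⊆ [r] with 1 ≤ |S| ≤ t−1 one has E[∏_{i∈S} x_i] = 0. -/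
open Finset

/-- The ±1 sign encoded by a Boolean (`true ↦ +1`). -/
noncomputable def sgn (b : Bool) : ℝ := if b then 1 else -1

/-- `μ` is a probability distribution on the finite type `α`. -/
def IsDist {α : Type} [Fintype α] (μ : α → ℝ) : Prop :=
  (∀ x, 0 ≤ μ x) ∧ ∑ x, μ x = 1

namespace BoolCube

variable {ι : Type*} [DecidableEq ι]

/-- The character `x ↦ x^S` of the Boolean cube. -/
noncomputable def chi (S : Finset ι) (x : ι → Bool) : ℝ := ∏ i ∈ S, sgn (x i)

/-- Flip the `i`-th coordinate of `x`. -/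
def flip (i : ι) (x : ι → Bool) : ι → Bool := Function.update x i (!x i)

lemma sgn_sq (b : Bool) : sgn b ^ 2 = 1 := by cases b <;> simp [sgn]

lemma sgn_not (b : Bool) : sgn (!b) = -sgn b := by cases b <;> simp [sgn]

lemma flip_flip (i : ι) (x : ι → Bool) : flip i (flip i x) = x := by
  simp [flip]

lemma sgn_flip (i : ι) (x : ι → Bool) : sgn (flip i x i) = -sgn (x i) := by
  simp [flip, sgn_not]

lemma chi_flip_of_notMem {i : ι} {S : Finset ι} (h : i ∉ S) (x : ι → Bool) :
    chi S (flip i x) = chi S x := by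
  refine prod_congr rfl fun j hj => ?_
  have : j ≠ i := fun e => h (e ▸ hj)
  simp [flip, this]

lemma chi_insert {i : ι} {S : Finset ι} (h : i ∉ S) (x : ι → Bool) :
    chi (insert i S) x = sgn (x i) * chi S x := prod_insert h

lemma chi_flip_of_mem {i : ι} {S : Finset ι} (h : i ∈ S) (x : ι → Bool) :
    chi S (flip i x) = -chi S x := by
  rw [← insert_erase h, chi_insert (notMem_erase i S), chi_insert (notMem_erase i S),
    chi_flip_of_notMem (notMem_erase i S), sgn_flip, neg_mul]

/-- The part of a Fourier expansion supported on subsets of `T`. -/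
noncomputable def partialSum (c : Finset ι → ℝ) (T : Finset ι) (x : ι → Bool) : ℝ :=
  ∑ S ∈ T.powerset, c S * chi S x

lemma partialSum_insert (c : Finset ι → ℝ) {i : ι} {T : Finset ι} (hi : i ∉ T) (x : ι → Bool) :
    partialSum c (insert i T) x =
      partialSum c T x + sgn (x i) * partialSum (fun S => c (insert i S)) T x := by
  unfold partialSum
  rw [sum_powerset_insert hi, mul_sum]
  congr 1
  refine sum_congr rfl fun S hS => ?_
  rw [chi_insert (fun h => hi (mem_powerset.1 hS h))]
  ring

lemma partialSum_flip (c : Finset ι → ℝ) {i : ι} {T : Finset ι} (hi : i ∉ T) (x : ι → Bool) :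
    partialSum c T (flip i x) = partialSum c T x := by
  refine sum_congr rfl fun S hS => ?_
  rw [chi_flip_of_notMem (fun h => hi (mem_powerset.1 hS h))]

/-- The function on the cube with Fourier coefficients `c`. -/
noncomputable def expansion {ι : Type*} [Fintype ι] (c : Finset ι → ℝ) (x : ι → Bool) : ℝ := ∑ S, c S * chi S x

lemma expansion_eq_partialSum {ι : Type*} [Fintype ι] (c : Finset ι → ℝ) : expansion c = partialSum c univ := by
  ext x; simp [expansion, partialSum]

variable [Fintype ι]

lemma sum_flip (i : ι) (g : (ι → Bool) → ℝ) : ∑ x, g (flip i x) = ∑ x, g x :=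
  Equiv.sum_comp (Function.Involutive.toPerm (flip i) (flip_flip i)) g

lemma sum_eq_zero_of_flip_neg (i : ι) (g : (ι → Bool) → ℝ) (h : ∀ x, g (flip i x) = -g x) :
    ∑ x, g x = 0 := by
  have h1 := sum_flip i g
  simp only [h, sum_neg_distrib] at h1
  linarith

lemma sum_chi {S : Finset ι} (hS : S.Nonempty) : ∑ x, chi S x = 0 := by
  obtain ⟨i, hi⟩ := hS
  exact sum_eq_zero_of_flip_neg i _ (chi_flip_of_mem hi)

lemma sum_partialSum_sq (T : Finset ι) : ∀ c : Finset ι → ℝ,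
    ∑ x, partialSum c T x ^ 2 = 2 ^ Fintype.card ι * ∑ S ∈ T.powerset, c S ^ 2 := by
  induction T using Finset.induction_on with
  | empty => intro c; simp [partialSum, chi]
  | insert i T hi ih =>
    intro c
    set g := partialSum c T with hg
    set h := partialSum (fun S => c (insert i S)) T with hh
    have hodd : ∑ x, sgn (x i) * (g x * h x) = 0 := by
      refine sum_eq_zero_of_flip_neg i _ fun x => ?_
      rw [sgn_flip, hg, hh, partialSum_flip _ hi, partialSum_flip _ hi]; ring
    have hexp : ∀ x, partialSum c (insert i T) x ^ 2 =
        g x ^ 2 + h x ^ 2 + 2 * (sgn (x i) * (g x * h x)) := by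
      intro x
      rw [partialSum_insert c hi]
      linear_combination h x ^ 2 * sgn_sq (x i)
    simp_rw [hexp, sum_add_distrib, ← mul_sum, hodd]
    rw [sum_powerset_insert hi, hg, hh, ih, ih]
    ring

/-- Bonami's hypercontractive inequality between the second and fourth moments. -/
lemma sum_partialSum_pow_four_le (T : Finset ι) : ∀ c : Finset ι → ℝ,
    ∑ x, partialSum c T x ^ 4 ≤
      2 ^ Fintype.card ι * (∑ S ∈ T.powerset, 3 ^ S.card * c S ^ 2) ^ 2 := by
  induction T using Finset.induction_on with
  | empty =>
    intro c
    simp only [partialSum, chi, powerset_empty, sum_singleton, prod_empty, card_empty]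
    simp
    exact le_of_eq (by ring)
  | insert i T hi ih =>
    intro c
    set g := partialSum c T with hg
    set h := partialSum (fun S => c (insert i S)) T with hh
    have hodd : ∑ x, sgn (x i) * (g x * h x * (g x ^ 2 + h x ^ 2)) = 0 := by
      refine sum_eq_zero_of_flip_neg i _ fun x => ?_
      rw [sgn_flip, hg, hh, partialSum_flip _ hi, partialSum_flip _ hi]; ring
    have hexp : ∀ x, partialSum c (insert i T) x ^ 4 =
        g x ^ 4 + 6 * (g x ^ 2 * h x ^ 2) + h x ^ 4 +
          4 * (sgn (x i) * (g x * h x * (g x ^ 2 + h x ^ 2))) := by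
      intro x
      rw [partialSum_insert c hi]
      linear_combination (6 * g x ^ 2 * h x ^ 2 + 4 * sgn (x i) * g x * h x ^ 3 +
        h x ^ 4 * (sgn (x i) ^ 2 + 1)) * sgn_sq (x i)
    simp_rw [hexp, sum_add_distrib, ← mul_sum, hodd]
    have hG := ih c
    have hH := ih (fun S => c (insert i S))
    rw [← hg] at hG
    rw [← hh] at hH
    have hsplit : ∑ S ∈ (insert i T).powerset, (3 : ℝ) ^ S.card * c S ^ 2 =
        ∑ S ∈ T.powerset, 3 ^ S.card * c S ^ 2 +
          3 * ∑ S ∈ T.powerset, 3 ^ S.card * c (insert i S) ^ 2 := by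
      rw [sum_powerset_insert hi, mul_sum]
      congr 1
      refine sum_congr rfl fun S hS => ?_
      rw [card_insert_of_notMem (fun h => hi (mem_powerset.1 hS h))]
      ring
    rw [hsplit]
    set A := ∑ S ∈ T.powerset, (3 : ℝ) ^ S.card * c S ^ 2
    set B := ∑ S ∈ T.powerset, (3 : ℝ) ^ S.card * c (insert i S) ^ 2
    have hA : 0 ≤ A := sum_nonneg fun _ _ => by positivity
    have hB : 0 ≤ B := sum_nonneg fun _ _ => by positivity
    have hN : (0 : ℝ) < 2 ^ Fintype.card ι := by positivity
    set N : ℝ := 2 ^ Fintype.card ι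
    have hcs := sum_mul_sq_le_sq_mul_sq univ (fun x => g x ^ 2) (fun x => h x ^ 2)
    simp only [← pow_mul] at hcs
    have hmix : ∑ x, g x ^ 2 * h x ^ 2 ≤ N * A * B := by
      refine abs_le_of_sq_le_sq' ?_ (by positivity) |>.2
      calc _ ≤ _ := hcs
        _ ≤ (N * A ^ 2) * (N * B ^ 2) := 
          mul_le_mul hG hH (sum_nonneg fun _ _ => (even_two_mul 2).pow_nonneg _) (by positivity)
        _ = _ := by ring
    nlinarith [mul_nonneg hN.le (sq_nonneg B)]

lemma sum_expansion_sq (c : Finset ι → ℝ) :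
    ∑ x, expansion c x ^ 2 = 2 ^ Fintype.card ι * ∑ S, c S ^ 2 := by
  rw [expansion_eq_partialSum, sum_partialSum_sq, powerset_univ]

lemma sum_expansion_pow_four_le (c : Finset ι → ℝ) (d : ℕ) (hd : ∀ S, d < S.card → c S = 0) :
    ∑ x, expansion c x ^ 4 ≤ 2 ^ Fintype.card ι * (3 ^ d * ∑ S, c S ^ 2) ^ 2 := by
  rw [expansion_eq_partialSum]
  refine (sum_partialSum_pow_four_le univ c).trans ?_
  rw [powerset_univ, mul_sum]
  have : ∑ S, (3 : ℝ) ^ S.card * c S ^ 2 ≤ ∑ S, 3 ^ d * c S ^ 2 := by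
    refine sum_le_sum fun S _ => ?_
    rcases lt_or_ge d S.card with h | h
    · simp [hd S h]
    · gcongr; norm_num
  gcongr

lemma sum_expansion (c : Finset ι → ℝ) (h0 : c ∅ = 0) : ∑ x, expansion c x = 0 := by
  unfold expansion
  rw [sum_comm]
  refine sum_eq_zero fun S _ => ?_
  rw [← mul_sum]
  rcases S.eq_empty_or_nonempty with rfl | hS
  · simp [h0]
  · simp [sum_chi hS]

lemma expansion_sub_flip (c : Finset ι → ℝ) (i : ι) (x : ι → Bool) :
    expansion c x - expansion c (flip i x) =
      expansion (fun S => if i ∈ S then 2 * c S else 0) x := by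
  unfold expansion
  rw [← sum_sub_distrib]
  refine sum_congr rfl fun S _ => ?_
  by_cases h : i ∈ S
  · simp only [chi_flip_of_mem h, if_pos h]; ring
  · simp only [chi_flip_of_notMem h, if_neg h]; ring

/-- The total influence of a function of degree at most `d`. -/
lemma sum_sq_sub_flip_le (c : Finset ι → ℝ) (d : ℕ) (hd : ∀ S, d < S.card → c S = 0) :
    ∑ i, ∑ x, (expansion c x - expansion c (flip i x)) ^ 2 ≤
      2 ^ Fintype.card ι * (4 * d * ∑ S, c S ^ 2) := by
  simp_rw [expansion_sub_flip, sum_expansion_sq, ← mul_sum]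
  gcongr
  rw [sum_comm, mul_sum]
  refine sum_le_sum fun S _ => ?_
  have : ∀ i, (if i ∈ S then 2 * c S else 0) ^ 2 = if i ∈ S then 4 * c S ^ 2 else 0 := by
    intro i; split_ifs <;> ring
  simp_rw [this]
  rw [sum_ite_mem, univ_inter, sum_const, nsmul_eq_mul]
  rcases lt_or_ge d S.card with h | h
  · simp [hd S h]
  · have : (S.card : ℝ) ≤ d := by exact_mod_cast h
    nlinarith [sq_nonneg (c S)]

/-- The first moment of a function of degree at most `d` with unit second moment. -/
lemma le_sum_abs_expansion (c : Finset ι → ℝ) (d : ℕ) (hd : ∀ S, d < S.card → c S = 0)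
    (h1 : ∑ S, c S ^ 2 = 1) :
    2 ^ Fintype.card ι / 3 ^ d ≤ ∑ x, |expansion c x| := by
  have h2 := sum_expansion_sq c
  have h4 := sum_expansion_pow_four_le c d hd
  rw [h1, mul_one] at h2 h4
  have hB : (0 : ℝ) < 3 ^ d := by positivity
  set B : ℝ := 3 ^ d
  have key : ∀ y : ℝ, 3 / 2 / B * y ^ 2 - 1 / 2 / B ^ 3 * y ^ 4 ≤ |y| := by
    intro y
    obtain ⟨z, hz⟩ : ∃ z, |y| = B * z := ⟨|y| / B, by field_simp⟩
    have hz0 : 0 ≤ z := by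
      by_contra! h
      have := abs_nonneg y
      nlinarith
    have e2 : y ^ 2 = B ^ 2 * z ^ 2 := by rw [← sq_abs, hz]; ring
    have e4 : y ^ 4 = B ^ 4 * z ^ 4 := by
      rw [show y ^ 4 = (y ^ 2) ^ 2 by ring, e2]; ring
    have : 3 / 2 / B * y ^ 2 - 1 / 2 / B ^ 3 * y ^ 4 = B * (3 / 2 * z ^ 2 - 1 / 2 * z ^ 4) := by
      rw [e2, e4]; field_simp
    rw [this, hz]
    gcongr
    nlinarith [mul_nonneg hz0 (mul_nonneg (sq_nonneg (z - 1)) (by linarith : 0 ≤ z + 2))]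
  calc 2 ^ Fintype.card ι / B
      = 3 / 2 / B * 2 ^ Fintype.card ι -
          1 / 2 / B ^ 3 * (2 ^ Fintype.card ι * B ^ 2) := by field_simp; norm_num
    _ ≤ 3 / 2 / B * ∑ x, expansion c x ^ 2 - 1 / 2 / B ^ 3 * ∑ x, expansion c x ^ 4 := by
        rw [h2]; gcongr
    _ = ∑ x, (3 / 2 / B * expansion c x ^ 2 - 1 / 2 / B ^ 3 * expansion c x ^ 4) := by
        rw [sum_sub_distrib, mul_sum, mul_sum]
    _ ≤ _ := sum_le_sum fun x _ => key _

lemma choose_succ_le_choose {n u : ℕ} (h : n ≤ 2 * u + 1) : n.choose (u + 1) ≤ n.choose u := by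
  have h1 := Nat.choose_succ_right_eq n u
  have h2 : n - u ≤ u + 1 := by omega
  have h3 : n.choose (u + 1) * (u + 1) ≤ n.choose u * (u + 1) :=
    h1 ▸ Nat.mul_le_mul_left _ h2
  exact Nat.le_of_mul_le_mul_right h3 (Nat.succ_pos u)

lemma choose_anti {n u v : ℕ} (h : n ≤ 2 * u + 1) (huv : u ≤ v) : n.choose v ≤ n.choose u := by
  induction v, huv using Nat.le_induction with
  | base => exact le_rfl
  | succ v hv ih => exact (choose_succ_le_choose (by omega)).trans ih

lemma choose_le_two_mul_choose {c u k : ℕ} (hcu : c ≤ u) (huk : u < k) :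
    (2 * c).choose k ≤ 2 * (2 * c - 1).choose u := by
  rcases Nat.eq_zero_or_pos c with rfl | hc
  · rw [Nat.choose_eq_zero_of_lt (by omega)]; omega
  obtain ⟨n, hn⟩ : ∃ n, 2 * c = n + 1 := ⟨2 * c - 1, by omega⟩
  obtain ⟨k, rfl⟩ : ∃ j, k = j + 1 := ⟨k - 1, by omega⟩
  rw [hn, Nat.choose_succ_succ', Nat.add_sub_cancel]
  have h1 : n.choose k ≤ n.choose u := choose_anti (by omega) (by omega)
  have h2 : n.choose (k + 1) ≤ n.choose u := choose_anti (by omega) (by omega)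
  omega

/-- The negative part of a function that is positive on a grid of step `m` to the right of the
centre of the binomial distribution is controlled by its increments. -/
lemma sum_neg_part_right_le {c m a : ℕ} (hm : 0 < m) (hac : m * a ≤ c) (q : ℕ → ℝ)
    (hq : ∀ j ≤ a, 0 < q (c + m * j)) :
    ∑ k ∈ Icc c (c + m * a), ((2 * c).choose k : ℝ) * max (-q k) 0 ≤
      2 * m * ∑ u ∈ range (2 * c), ((2 * c - 1).choose u : ℝ) * |q (u + 1) - q u| := by
  have hk : ∀ k ∈ Icc c (c + m * a), ((2 * c).choose k : ℝ) * max (-q k) 0 ≤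
      ∑ u ∈ range (2 * c), if u < k ∧ k ≤ u + m then
        2 * (((2 * c - 1).choose u : ℝ) * |q (u + 1) - q u|) else 0 := by
    intro k hk
    rw [mem_Icc] at hk
    obtain ⟨j, i, hi, hj, hki⟩ : ∃ j i, i < m ∧ j ≤ a ∧ k = c + m * j + i := by
      refine ⟨(k - c) / m, (k - c) % m, Nat.mod_lt _ hm, ?_, ?_⟩
      · exact Nat.div_le_of_le_mul (by omega)
      · have := Nat.div_add_mod (k - c) m
        omega
    set b := c + m * j with hb
    have hneg : max (-q k) 0 ≤ ∑ u ∈ Ico b k, |q (u + 1) - q u| := by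
      refine max_le ?_ (sum_nonneg fun _ _ => abs_nonneg _)
      have h1 : ∑ u ∈ Ico b k, (q (u + 1) - q u) = q k - q b :=
        sum_Ico_sub q (by omega)
      have h2 := neg_abs_le (∑ u ∈ Ico b k, (q (u + 1) - q u))
      have h3 := abs_sum_le_sum_abs (fun u => q (u + 1) - q u) (Ico b k)
      have h4 := hq j hj
      linarith
    rw [← sum_filter]
    calc ((2 * c).choose k : ℝ) * max (-q k) 0
        ≤ ((2 * c).choose k : ℝ) * ∑ u ∈ Ico b k, |q (u + 1) - q u| := by gcongr
      _ = ∑ u ∈ Ico b k, ((2 * c).choose k : ℝ) * |q (u + 1) - q u| := mul_sum _ _ _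
      _ ≤ ∑ u ∈ Ico b k, 2 * (((2 * c - 1).choose u : ℝ) * |q (u + 1) - q u|) := by
          refine sum_le_sum fun u hu => ?_
          rw [mem_Ico] at hu
          have : ((2 * c).choose k : ℝ) ≤ 2 * ((2 * c - 1).choose u : ℝ) := by
            exact_mod_cast choose_le_two_mul_choose (by omega) hu.2
          rw [← mul_assoc]
          gcongr
      _ ≤ _ := by
          refine sum_le_sum_of_subset_of_nonneg (fun u hu => ?_) fun _ _ _ => by positivity
          rw [mem_Ico] at hu
          rw [mem_filter, mem_range]
          omega
  refine (sum_le_sum hk).trans ?_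
  rw [sum_comm, mul_sum]
  refine sum_le_sum fun u _ => ?_
  rw [← sum_filter, sum_const, nsmul_eq_mul]
  have hcard : (((Icc c (c + m * a)).filter fun k => u < k ∧ k ≤ u + m).card : ℝ) ≤ m := by
    have : ((Icc c (c + m * a)).filter fun k => u < k ∧ k ≤ u + m) ⊆ Ioc u (u + m) := by
      intro k hk
      rw [mem_filter] at hk
      exact mem_Ioc.2 hk.2
    have h := card_le_card this
    rw [Nat.card_Ioc] at h
    exact_mod_cast h.trans (by omega)
  have h0 : 0 ≤ ((2 * c - 1).choose u : ℝ) * |q (u + 1) - q u| := by positivity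
  nlinarith

lemma sum_neg_part_le {c m a : ℕ} (hm : 0 < m) (hac : m * a ≤ c) (q : ℕ → ℝ)
    (hq : ∀ j ≤ a, 0 < q (c + m * j)) (hq' : ∀ j ≤ a, 0 < q (c - m * j)) :
    ∑ k ∈ Icc (c - m * a) (c + m * a), ((2 * c).choose k : ℝ) * max (-q k) 0 ≤
      4 * m * ∑ u ∈ range (2 * c), ((2 * c - 1).choose u : ℝ) * |q (u + 1) - q u| := by
  have hR := sum_neg_part_right_le hm hac q hq
  have hL := sum_neg_part_right_le hm hac (fun k => q (2 * c - k)) fun j hj => by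
    have := Nat.mul_le_mul_left m hj
    have e : 2 * c - (c + m * j) = c - m * j := by omega
    simpa only [e] using hq' j hj
  have hrefl : ∑ u ∈ range (2 * c), ((2 * c - 1).choose u : ℝ) *
      |q (2 * c - (u + 1)) - q (2 * c - u)| =
      ∑ u ∈ range (2 * c), ((2 * c - 1).choose u : ℝ) * |q (u + 1) - q u| := by
    rw [← sum_range_reflect]
    refine sum_congr rfl fun u hu => ?_
    rw [mem_range] at hu
    rw [Nat.choose_symm (by omega), abs_sub_comm,
      show 2 * c - (2 * c - 1 - u) = u + 1 by omega,
      show 2 * c - (2 * c - 1 - u + 1) = u by omega]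
  simp only [hrefl] at hL
  have hLsum : ∑ k ∈ Icc (c - m * a) c, ((2 * c).choose k : ℝ) * max (-q k) 0 =
      ∑ k ∈ Icc c (c + m * a), ((2 * c).choose k : ℝ) * max (-q (2 * c - k)) 0 := by
    refine sum_nbij' (fun k => 2 * c - k) (fun k => 2 * c - k) ?_ ?_ ?_ ?_ ?_ <;>
      intro k hk <;> simp only [mem_Icc] at hk ⊢ <;> try omega
    rw [Nat.choose_symm (by omega), show 2 * c - (2 * c - k) = k by omega]
  have hunion : Icc (c - m * a) (c + m * a) ⊆ Icc (c - m * a) c ∪ Icc c (c + m * a) := by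
    intro k hk
    simp only [mem_union, mem_Icc] at hk ⊢
    omega
  have h1 := sum_le_sum_of_subset_of_nonneg (f := fun k => ((2 * c).choose k : ℝ) * max (-q k) 0)
    hunion fun _ _ _ => by positivity
  have h2 := sum_union_inter (s₁ := Icc (c - m * a) c) (s₂ := Icc c (c + m * a))
    (f := fun k => ((2 * c).choose k : ℝ) * max (-q k) 0)
  have h3 : 0 ≤ ∑ k ∈ Icc (c - m * a) c ∩ Icc c (c + m * a),
      ((2 * c).choose k : ℝ) * max (-q k) 0 := sum_nonneg fun _ _ => by positivity
  linarith

/-- The number of `+1` entries of a string. -/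
def count {n : ℕ} (x : Fin n → Bool) : ℕ := (univ.filter fun i => x i = true).card

lemma sum_count {n : ℕ} (g : ℕ → ℝ) :
    ∑ x : Fin n → Bool, g (count x) = ∑ k ∈ range (n + 1), (n.choose k : ℝ) * g k := by
  have h := sum_powerset_apply_card g (x := (univ : Finset (Fin n)))
  simp only [card_univ, Fintype.card_fin, nsmul_eq_mul, powerset_univ] at h
  rw [← h]
  refine sum_nbij' (fun x => univ.filter fun i => x i = true) (fun S i => decide (i ∈ S))
    ?_ ?_ ?_ ?_ ?_ <;> intros <;> simp [count]

lemma exists_perm_of_count_eq {n : ℕ} {x x' : Fin n → Bool} (h : count x = count x') :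
    ∃ π : Equiv.Perm (Fin n), x' ∘ π = x := by
  have hc : Fintype.card {i // x i = true} = Fintype.card {i // x' i = true} := by
    simpa [Fintype.card_subtype, count] using h
  refine ⟨(Fintype.equivOfCardEq hc).extendSubtype, funext fun i => ?_⟩
  by_cases hi : x i = true
  · simpa [hi] using (Fintype.equivOfCardEq hc).extendSubtype_mem i hi
  · have := (Fintype.equivOfCardEq hc).extendSubtype_not_mem i hi
    simp_all

lemma exists_count_eq {n k : ℕ} (h : k ≤ n) : ∃ x : Fin n → Bool, count x = k := by
  obtain ⟨S, -, hS⟩ := exists_subset_card_eq (s := (univ : Finset (Fin n))) (n := k) (by simpa)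
  exact ⟨fun i => decide (i ∈ S), by simp [count, hS]⟩

lemma count_flip_of_false {n : ℕ} {x : Fin n → Bool} {i : Fin n} (hi : x i = false) :
    count (flip i x) = count x + 1 := by
  have : (univ.filter fun j => flip i x j = true) =
      insert i (univ.filter fun j => x j = true) := by
    ext j
    by_cases hj : j = i
    · subst hj; rw [mem_filter]; simp [flip, hi]
    · rw [mem_filter]; simp [flip, hj]
  rw [count, this, card_insert_of_notMem (by simp [hi]), count]

lemma card_filter_false {n : ℕ} (x : Fin n → Bool) :
    (((univ.filter fun i => x i = false).card : ℕ) : ℝ) = n - count x := by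
  have h := card_filter_add_card_filter_not (s := (univ : Finset (Fin n))) fun i => x i = true
  simp only [Bool.not_eq_true, card_univ, Fintype.card_fin] at h
  rw [eq_sub_iff_add_eq, count]
  exact_mod_cast (add_comm _ _).trans h

lemma sum_sgn {n : ℕ} (x : Fin n → Bool) : ∑ i, sgn (x i) = 2 * count x - n := by
  have h : ∀ i, sgn (x i) = 2 * (if x i = true then 1 else 0) - 1 := by
    intro i; cases x i <;> norm_num [sgn]
  simp_rw [h]
  rw [sum_sub_distrib, ← mul_sum, sum_boole]
  simp [count]

/-- The increments of a symmetric function, as a sum over the edges of the cube. -/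
lemma mul_sum_choose_abs_sub_le {n : ℕ} (hn : 0 < n) (q : ℕ → ℝ) :
    n * ∑ u ∈ range n, ((n - 1).choose u : ℝ) * |q (u + 1) - q u| ≤
      ∑ i, ∑ x : Fin n → Bool, |q (count x) - q (count (flip i x))| := by
  have h1 : ∀ x : Fin n → Bool, ((n : ℝ) - count x) * |q (count x + 1) - q (count x)| ≤
      ∑ i, |q (count x) - q (count (flip i x))| := by
    intro x
    rw [← card_filter_false, ← nsmul_eq_mul, ← sum_const]
    refine (sum_le_sum fun i hi => ?_).trans
      (sum_le_sum_of_subset_of_nonneg (filter_subset _ _) fun _ _ _ => abs_nonneg _)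
    rw [count_flip_of_false (mem_filter.1 hi).2, abs_sub_comm]
  rw [sum_comm]
  refine le_trans (le_of_eq ?_) (sum_le_sum fun x _ => h1 x)
  rw [sum_count (n := n) (fun k => ((n : ℝ) - k) * |q (k + 1) - q k|), sum_range_succ, mul_sum]
  simp only [sub_self, zero_mul, mul_zero, add_zero]
  refine sum_congr rfl fun u hu => ?_
  rw [mem_range] at hu
  obtain ⟨n, rfl⟩ : ∃ m, n = m + 1 := ⟨n - 1, by omega⟩
  have h := Nat.choose_mul_succ_eq n u
  have h' : (n.choose u : ℝ) * ((n + 1 : ℕ) : ℝ) =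
      ((n + 1).choose u : ℝ) * (((n + 1 : ℕ) : ℝ) - u) := by
    rw [← Nat.cast_sub (by omega)]
    exact_mod_cast h
  rw [Nat.add_sub_cancel]
  linear_combination |q (u + 1) - q u| * h'

lemma sum_exp_mul_sum_sgn {n : ℕ} (lam : ℝ) :
    ∑ x : Fin n → Bool, Real.exp (lam * ∑ i, sgn (x i)) = (2 * Real.cosh lam) ^ n := by
  simp_rw [mul_sum, Real.exp_sum]
  have h := prod_univ_sum (fun _ : Fin n => (univ : Finset Bool))
    fun _ b => Real.exp (lam * sgn b)
  rw [Fintype.piFinset_univ] at h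
  rw [← h]
  simp [sgn, Real.cosh_eq]
  ring

/-- Hoeffding's bound for the number of unbalanced strings. -/
lemma card_tail_le {n : ℕ} (hn : 0 < n) {A : ℝ} (hA : 0 ≤ A) (s : Finset (Fin n → Bool))
    (hs : ∀ x ∈ s, A ≤ |2 * (count x : ℝ) - n|) :
    (s.card : ℝ) ≤ 2 * 2 ^ n * Real.exp (-(A ^ 2 / (2 * n))) := by
  have hn' : (0 : ℝ) < n := by exact_mod_cast hn
  set lam : ℝ := A / n with hlam
  have hlam0 : 0 ≤ lam := by positivity
  have h1 : ∀ x ∈ s, Real.exp (lam * A) ≤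
      Real.exp (lam * ∑ i, sgn (x i)) + Real.exp (-lam * ∑ i, sgn (x i)) := by
    intro x hx
    have h := hs x hx
    rw [sum_sgn]
    rcases le_abs.1 h with h | h
    · have := Real.exp_le_exp.2 (mul_le_mul_of_nonneg_left h hlam0)
      linarith [Real.exp_pos (-lam * (2 * (count x : ℝ) - n))]
    · have := Real.exp_le_exp.2 (mul_le_mul_of_nonneg_left h hlam0)
      rw [mul_neg, ← neg_mul] at this
      linarith [Real.exp_pos (lam * (2 * (count x : ℝ) - n))]
  have h2 : (s.card : ℝ) * Real.exp (lam * A) ≤ 2 * (2 * Real.cosh lam) ^ n := by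
    calc (s.card : ℝ) * Real.exp (lam * A) = ∑ x ∈ s, Real.exp (lam * A) := by simp
      _ ≤ _ := sum_le_sum h1
      _ ≤ ∑ x : Fin n → Bool,
          (Real.exp (lam * ∑ i, sgn (x i)) + Real.exp (-lam * ∑ i, sgn (x i))) :=
        sum_le_sum_of_subset_of_nonneg (subset_univ _) fun _ _ _ => by positivity
      _ = _ := by
        rw [sum_add_distrib, sum_exp_mul_sum_sgn, sum_exp_mul_sum_sgn, Real.cosh_neg]; ring
  have h3 : (2 * Real.cosh lam) ^ n ≤ 2 ^ n * Real.exp (n * (lam ^ 2 / 2)) := by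
    rw [mul_pow, Real.exp_nat_mul]
    have := Real.cosh_le_exp_half_sq lam
    have := (Real.cosh_pos lam).le
    gcongr
  calc (s.card : ℝ) = s.card * Real.exp (lam * A) * Real.exp (-(lam * A)) := by
        rw [mul_assoc, ← Real.exp_add]; simp
    _ ≤ 2 * (2 ^ n * Real.exp (n * (lam ^ 2 / 2))) * Real.exp (-(lam * A)) := by
        refine mul_le_mul_of_nonneg_right (h2.trans ?_) (Real.exp_pos _).le
        linarith
    _ = 2 * 2 ^ n * Real.exp (n * (lam ^ 2 / 2) + -(lam * A)) := by rw [Real.exp_add]; ring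
    _ = _ := by
        congr 2
        rw [hlam]
        field_simp
        ring

lemma sum_choose_abs_sub_le {n d : ℕ} (hn : 0 < n) (f : Finset (Fin n) → ℝ)
    (hd : ∀ S, d < S.card → f S = 0) (h1 : ∑ S, f S ^ 2 = 1) (q : ℕ → ℝ)
    (hq : ∀ x, expansion f x = q (count x)) :
    ∑ u ∈ range n, ((n - 1).choose u : ℝ) * |q (u + 1) - q u| ≤
      2 ^ n * (2 * Real.sqrt (d / n)) := by
  have hn' : (0 : ℝ) < n := by exact_mod_cast hn
  have hedge := mul_sum_choose_abs_sub_le hn q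
  have hinf := sum_sq_sub_flip_le f d hd
  simp only [hq, h1, Fintype.card_fin, mul_one] at hinf
  set D := ∑ u ∈ range n, ((n - 1).choose u : ℝ) * |q (u + 1) - q u|
  have hD : 0 ≤ D := sum_nonneg fun _ _ => by positivity
  have hcs := sq_sum_le_card_mul_sum_sq (s := (univ : Finset (Fin n × (Fin n → Bool))))
    (f := fun p => |q (count p.2) - q (count (flip p.1 p.2))|)
  simp only [Fintype.sum_prod_type, sq_abs, card_univ, Fintype.card_prod, Fintype.card_fin,
    Fintype.card_fun, Fintype.card_bool, Nat.cast_mul, Nat.cast_pow, Nat.cast_ofNat] at hcs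
  have hsq : (n * D) ^ 2 ≤ n * 2 ^ n * (2 ^ n * (4 * d)) := by
    calc (n * D) ^ 2 ≤ _ := pow_le_pow_left₀ (by positivity) hedge 2
      _ ≤ _ := hcs
      _ ≤ _ := by gcongr
  refine (abs_le_of_sq_le_sq' ?_ (by positivity)).2
  have hs : Real.sqrt (d / n) ^ 2 = d / n := Real.sq_sqrt (by positivity)
  have e : (2 ^ n * (2 * Real.sqrt (d / n))) ^ 2 = (2 ^ n) ^ 2 * (4 * (d / n : ℝ)) := by
    rw [mul_pow, mul_pow, hs]; ring
  rw [e]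
  refine le_of_mul_le_mul_left ?_ (show (0 : ℝ) < n ^ 2 by positivity)
  calc (n : ℝ) ^ 2 * D ^ 2 = (n * D) ^ 2 := by ring
    _ ≤ _ := hsq
    _ = _ := by field_simp

/-- A symmetric mean-zero function of degree at most `d` that is positive on the layers of a grid
of step `m` around the middle layer forces the grid to be coarse or short. -/
theorem inv_le_of_pos_on_grid {c m a d : ℕ} (hc : 0 < c) (hm : 0 < m) (hac : m * a ≤ c)
    (f : Finset (Fin (2 * c)) → ℝ) (h0 : f ∅ = 0) (hd : ∀ S, d < S.card → f S = 0)
    (h1 : ∑ S, f S ^ 2 = 1)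
    (hsymm : ∀ x x', count x = count x' → expansion f x = expansion f x')
    (hpos : ∀ x, ∀ j ≤ a, count x = c + m * j ∨ count x = c - m * j → 0 < expansion f x) :
    1 / (2 * 3 ^ d) ≤ 8 * m * Real.sqrt (d / (2 * c : ℕ)) +
      Real.sqrt 2 * Real.exp (-((2 * m * a : ℕ) ^ 2 / (4 * (2 * c : ℕ)))) := by
  obtain ⟨q, hq⟩ : ∃ q : ℕ → ℝ, ∀ x, expansion f x = q (count x) := by
    classical
    refine ⟨fun k => if h : ∃ x : Fin (2 * c) → Bool, count x = k then expansion f h.choose else 0,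
      fun x => ?_⟩
    have h : ∃ x' : Fin (2 * c) → Bool, count x' = count x := ⟨x, rfl⟩
    simp only [dif_pos h]
    exact hsymm _ _ h.choose_spec.symm
  set N : ℝ := 2 ^ (2 * c) with hN
  have hN0 : 0 < N := by positivity
  have hD := sum_choose_abs_sub_le (by omega) f hd h1 q hq
  have hqpos : ∀ j ≤ a, 0 < q (c + m * j) ∧ 0 < q (c - m * j) := by
    intro j hj
    have := Nat.mul_le_mul_left m hj
    obtain ⟨x, hx⟩ := exists_count_eq (n := 2 * c) (k := c + m * j) (by omega)
    obtain ⟨x', hx'⟩ := exists_count_eq (n := 2 * c) (k := c - m * j) (by omega)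
    rw [← hx, ← hx', ← hq, ← hq]
    exact ⟨hpos x j hj (Or.inl hx), hpos x' j hj (Or.inr hx')⟩
  have hbulk := sum_neg_part_le hm hac q (fun j hj => (hqpos j hj).1) fun j hj => (hqpos j hj).2
  have habs := le_sum_abs_expansion f d hd h1
  rw [Fintype.card_fin, ← hN] at habs
  have hmean := sum_expansion f h0
  have hneg : ∑ x, |expansion f x| = 2 * ∑ x, max (-expansion f x) 0 := by
    have : ∀ y : ℝ, |y| = y + 2 * max (-y) 0 := by
      intro y
      rcases le_total 0 y with h | h
      · rw [abs_of_nonneg h, max_eq_right (by linarith)]; ring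
      · rw [abs_of_nonpos h, max_eq_left (by linarith)]; ring
    simp_rw [fun x => this (expansion f x), sum_add_distrib, hmean, ← mul_sum, zero_add]
  set bulk := univ.filter fun x : Fin (2 * c) → Bool => count x ∈ Icc (c - m * a) (c + m * a)
  have hsplit := sum_add_sum_compl bulk fun x => max (-expansion f x) 0
  have hbulk_eq : ∑ x ∈ bulk, max (-expansion f x) 0 =
      ∑ k ∈ Icc (c - m * a) (c + m * a), ((2 * c).choose k : ℝ) * max (-q k) 0 := by
    rw [sum_filter]
    simp_rw [hq]
    rw [sum_count (fun k => if k ∈ Icc (c - m * a) (c + m * a) then max (-q k) 0 else 0)]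
    simp_rw [mul_ite, mul_zero]
    rw [← sum_filter]
    congr 1
    ext k
    simp only [mem_filter, mem_range, mem_Icc]
    omega
  have htail_card := card_tail_le (n := 2 * c) (by omega) (A := (2 * m * a : ℕ)) (by positivity)
    bulkᶜ fun x hx => by
      simp only [bulk, mem_compl, mem_filter, mem_univ, true_and, mem_Icc, not_and_or,
        not_le] at hx
      rcases hx with hx | hx
      · refine le_abs.2 (Or.inr ?_)
        have : 2 * m * a + 2 * count x ≤ 2 * c := by
          have : 2 * m * a = 2 * (m * a) := by ring
          omega
        have : ((2 * m * a : ℕ) : ℝ) + 2 * count x ≤ (2 * c : ℕ) := by exact_mod_cast this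
        linarith
      · refine le_abs.2 (Or.inl ?_)
        have : 2 * m * a + 2 * c ≤ 2 * count x := by
          have : 2 * m * a = 2 * (m * a) := by ring
          omega
        have : ((2 * m * a : ℕ) : ℝ) + (2 * c : ℕ) ≤ 2 * count x := by exact_mod_cast this
        linarith
  have htail : ∑ x ∈ bulkᶜ, max (-expansion f x) 0 ≤
      N * (Real.sqrt 2 * Real.exp (-((2 * m * a : ℕ) ^ 2 / (4 * (2 * c : ℕ))))) := by
    refine (abs_le_of_sq_le_sq' ?_ (by positivity)).2
    calc (∑ x ∈ bulkᶜ, max (-expansion f x) 0) ^ 2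
        ≤ bulkᶜ.card * ∑ x ∈ bulkᶜ, max (-expansion f x) 0 ^ 2 := sq_sum_le_card_mul_sum_sq
      _ ≤ bulkᶜ.card * ∑ x, expansion f x ^ 2 := by
          gcongr
          refine (sum_le_sum fun x _ => ?_).trans
            (sum_le_sum_of_subset_of_nonneg (subset_univ _) fun _ _ _ => sq_nonneg _)
          rw [← sq_abs (expansion f x)]
          gcongr
          exact max_le (neg_le_abs _) (abs_nonneg _)
      _ = bulkᶜ.card * N := by rw [sum_expansion_sq, h1, Fintype.card_fin, mul_one]
      _ ≤ 2 * N * Real.exp (-((2 * m * a : ℕ) ^ 2 / (2 * (2 * c : ℕ)))) * N := by gcongr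
      _ = _ := by
          rw [mul_pow, mul_pow, Real.sq_sqrt (by norm_num), ← Real.exp_nat_mul,
            show ((2 : ℕ) : ℝ) * -(((2 * m * a : ℕ) : ℝ) ^ 2 / (4 * (2 * c : ℕ))) =
              -(((2 * m * a : ℕ) : ℝ) ^ 2 / (2 * (2 * c : ℕ))) by push_cast; field_simp; ring]
          ring
  have hm0 : (0 : ℝ) ≤ 4 * m := by positivity
  have hfin : N * (1 / (2 * 3 ^ d)) ≤ N * (8 * m * Real.sqrt (d / (2 * c : ℕ)) +
      Real.sqrt 2 * Real.exp (-((2 * m * a : ℕ) ^ 2 / (4 * (2 * c : ℕ))))) := by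
    have e : N * (1 / (2 * 3 ^ d)) = N / 3 ^ d / 2 := by field_simp
    have := mul_le_mul_of_nonneg_left hD hm0
    rw [e]
    nlinarith
  exact le_of_mul_le_mul_left hfin hN0

/-- Either `0` is a convex combination of the vectors `v i`, or some linear functional is positive
on all of them. -/
lemma exists_weights_or_exists_functional {α β : Type*} [Fintype α] [Fintype β]
    (v : α → β → ℝ) :
    (∃ w : α → ℝ, (∀ i, 0 ≤ w i) ∧ ∑ i, w i = 1 ∧ ∀ b, ∑ i, w i * v i b = 0) ∨
      ∃ c : β → ℝ, ∀ i, 0 < ∑ b, c b * v i b := by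
  classical
  set L : (α → ℝ) →ₗ[ℝ] (β → ℝ) := ∑ i, (LinearMap.proj i).smulRight (v i) with hL
  have hLw : ∀ w b, L w b = ∑ i, w i * v i b := by
    intro w b; simp [hL]
  by_cases h : (0 : β → ℝ) ∈ L '' stdSimplex ℝ α
  · obtain ⟨w, hw, hw0⟩ := h
    exact Or.inl ⟨w, hw.1, hw.2, fun b => by rw [← hLw, hw0]; rfl⟩
  · right
    have hcont : Continuous L := L.continuous_of_finiteDimensional
    obtain ⟨φ, u, hφ0, hφ⟩ := geometric_hahn_banach_point_closed
      ((convex_stdSimplex ℝ α).linear_image L)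
      ((isCompact_stdSimplex ℝ α).image hcont).isClosed h
    refine ⟨fun b => φ (Pi.single b 1), fun i => ?_⟩
    have hv : L (Pi.single i 1) = v i := by
      ext b
      rw [hLw, sum_eq_single i] <;> simp +contextual
    have h1 := hφ (v i) ⟨Pi.single i 1, single_mem_stdSimplex ℝ i, hv⟩
    have h2 : φ (v i) = ∑ b, φ (Pi.single b 1) * v i b := by
      have := LinearMap.pi_apply_eq_sum_univ φ.toLinearMap (v i)
      simp only [ContinuousLinearMap.coe_coe, smul_eq_mul] at this
      rw [this]
      refine sum_congr rfl fun b _ => ?_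
      rw [mul_comm]
      congr 2
      ext j
      simp [Pi.single_apply, eq_comm]
    rw [map_zero] at hφ0
    rw [← h2]
    linarith

/-- The average of the character of `S` over all permutations of the coordinates. -/
noncomputable def permAverage {n : ℕ} (S : Finset (Fin n)) (x : Fin n → Bool) : ℝ :=
  (∑ π : Equiv.Perm (Fin n), ∏ i ∈ S, sgn (x (π i))) /
    (Fintype.card (Equiv.Perm (Fin n)) : ℝ)

lemma permAverage_comp {n : ℕ} (S : Finset (Fin n)) (x : Fin n → Bool) (σ : Equiv.Perm (Fin n)) :
    permAverage S (x ∘ σ) = permAverage S x := by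
  unfold permAverage
  congr 1
  exact Equiv.sum_comp (Equiv.mulLeft σ) fun π : Equiv.Perm (Fin n) => ∏ i ∈ S, sgn (x (π i))

lemma permAverage_eq_of_count_eq {n : ℕ} (S : Finset (Fin n)) {x x' : Fin n → Bool}
    (h : count x = count x') : permAverage S x = permAverage S x' := by
  obtain ⟨σ, rfl⟩ := exists_perm_of_count_eq h
  exact permAverage_comp S x' σ

/-- The Fourier coefficients of a combination of permutation averages. -/
noncomputable def symmCoeff {n : ℕ} (c : Finset (Fin n) → ℝ) (S : Finset (Fin n)) : ℝ :=
  (∑ π : Equiv.Perm (Fin n), c (S.map π.symm.toEmbedding)) /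
    (Fintype.card (Equiv.Perm (Fin n)) : ℝ)

lemma expansion_symmCoeff {n : ℕ} (c : Finset (Fin n) → ℝ) (x : Fin n → Bool) :
    expansion (symmCoeff c) x = ∑ S, c S * permAverage S x := by
  unfold expansion symmCoeff permAverage
  simp_rw [div_mul_eq_mul_div, mul_div_assoc', ← sum_div, sum_mul, mul_sum]
  congr 1
  rw [sum_comm, sum_comm (γ := Finset (Fin n))]
  refine sum_congr rfl fun π _ => ?_
  rw [← (Equiv.finsetCongr π).sum_comp]
  refine sum_congr rfl fun S _ => ?_
  simp [chi, Equiv.finsetCongr_apply, map_map]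

lemma symmCoeff_eq_zero {n : ℕ} {c : Finset (Fin n) → ℝ} {S : Finset (Fin n)}
    (h : ∀ T, T.card = S.card → c T = 0) : symmCoeff c S = 0 := by
  simp [symmCoeff, h]

lemma expansion_smul {ι : Type*} [Fintype ι] (s : ℝ) (f : Finset ι → ℝ) (x : ι → Bool) :
    expansion (fun S => s * f S) x = s * expansion f x := by
  simp [expansion, mul_sum, mul_assoc]

lemma count_eq_sum {n : ℕ} (x : Fin n → Bool) : count x = ∑ i, if x i = true then 1 else 0 := by
  simp [count]

lemma count_append {n r : ℕ} (h : n ≤ r) (z : Fin n → Bool) (y : Fin (r - n) → Bool) :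
    count (fun j : Fin r => if h : (j : ℕ) < n then z ⟨(j : ℕ), h⟩
      else y ⟨(j : ℕ) - n, Nat.sub_lt_sub_right (not_lt.1 h) j.isLt⟩) = count z + count y := by
  rw [count_eq_sum, count_eq_sum, count_eq_sum,
    ← (finSumFinEquiv.trans (finCongr (Nat.add_sub_cancel' h))).sum_comp, Fintype.sum_sum_type]
  simp

lemma numeric_bound {t m a c : ℕ} (ht : 0 < t) (hc : 0 < c)
    (h1 : 4 * Real.sqrt ((t : ℝ) * ((2 * c : ℕ) : ℝ)) < (2 * m * a : ℕ))
    (h2 : ((t : ℝ) - 1) * ((2 * m : ℕ) : ℝ) * (2 : ℝ) ^ ((4 : ℝ) * (t : ℝ)) ≤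
      Real.sqrt ((2 * c : ℕ) : ℝ)) :
    8 * m * Real.sqrt ((t - 1 : ℕ) / (2 * c : ℕ)) +
      Real.sqrt 2 * Real.exp (-((2 * m * a : ℕ) ^ 2 / (4 * (2 * c : ℕ)))) <
        1 / (2 * 3 ^ (t - 1)) := by
  obtain ⟨d, rfl⟩ : ∃ d, t = d + 1 := ⟨t - 1, by omega⟩
  have hr : (0 : ℝ) < (2 * c : ℕ) := by exact_mod_cast (by omega : 0 < 2 * c)
  set r : ℝ := ((2 * c : ℕ) : ℝ)
  rw [Nat.add_sub_cancel]
  have hpow : (2 : ℝ) ^ ((4 : ℝ) * ((d + 1 : ℕ) : ℝ)) = 16 ^ (d + 1) := by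
    rw [Real.rpow_mul (by norm_num), Real.rpow_natCast]; norm_num
  rw [hpow] at h2
  push_cast at h2
  have hP : (0 : ℝ) < 16 ^ (d + 1) := by positivity
  have hfirst : 8 * m * Real.sqrt (d / r) ≤ 4 / 16 ^ (d + 1) := by
    rw [Real.sqrt_div (by positivity), le_div_iff₀ hP, mul_div_assoc', div_mul_eq_mul_div,
      div_le_iff₀ (Real.sqrt_pos.2 hr)]
    have hsd : Real.sqrt d ≤ d := by
      rcases Nat.eq_zero_or_pos d with rfl | hd
      · simp
      · have : (1 : ℝ) ≤ d := by exact_mod_cast hd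
        exact Real.sqrt_le_left (by positivity) |>.2 (by nlinarith)
    calc 8 * (m : ℝ) * Real.sqrt d * 16 ^ (d + 1) ≤ 8 * m * d * 16 ^ (d + 1) := by gcongr
      _ = 4 * (((d : ℝ) + 1 - 1) * (2 * m) * 16 ^ (d + 1)) := by ring
      _ ≤ _ := by gcongr
  have hsecond : Real.sqrt 2 * Real.exp (-((2 * m * a : ℕ) ^ 2 / (4 * r))) ≤
      2 / 16 ^ (d + 1) := by
    have hs2 : Real.sqrt 2 ≤ 2 := Real.sqrt_le_left (by norm_num) |>.2 (by norm_num)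
    have hsq : 16 * (((d + 1 : ℕ) : ℝ) * r) ≤ ((2 * m * a : ℕ) : ℝ) ^ 2 := by
      have := pow_le_pow_left₀ (by positivity) h1.le 2
      rw [mul_pow, Real.sq_sqrt (by positivity)] at this
      linarith
    have hexp : Real.exp (-((2 * m * a : ℕ) ^ 2 / (4 * r))) ≤ (16 ^ (d + 1))⁻¹ := by
      rw [Real.exp_neg]
      gcongr
      have h16 : (16 : ℝ) ≤ Real.exp 4 := by
        have h2e : (2 : ℝ) ≤ Real.exp 1 := by linarith [Real.add_one_le_exp 1]
        calc (16 : ℝ) = 2 ^ 4 := by norm_num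
          _ ≤ Real.exp 1 ^ 4 := by gcongr
          _ = Real.exp 4 := by rw [← Real.exp_nat_mul]; norm_num
      calc (16 : ℝ) ^ (d + 1) ≤ Real.exp 4 ^ (d + 1) := by gcongr
        _ = Real.exp ((d + 1 : ℕ) * 4) := (Real.exp_nat_mul _ _).symm
        _ ≤ _ := by
          gcongr
          rw [le_div_iff₀ (by positivity)]
          linarith
    exact (mul_le_mul hs2 hexp (by positivity) (by norm_num)).trans_eq (div_eq_mul_inv _ _).symm
  have hlast : 4 / 16 ^ (d + 1) + 2 / 16 ^ (d + 1) < (1 : ℝ) / (2 * 3 ^ d) := by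
    rw [← add_div, div_lt_div_iff₀ hP (by positivity), pow_succ]
    have : (3 : ℝ) ^ d ≤ 16 ^ d := by gcongr; norm_num
    have : (0 : ℝ) < 16 ^ d := by positivity
    linarith
  linarith

/-- No combination of permutation averages of orders `1, …, d` is positive on all the layers of a
fine and long enough grid around the middle layer. -/
lemma exists_layer_nonpos {c m a d : ℕ} (hc : 0 < c) (hm : 0 < m) (hac : m * a ≤ c)
    (hbound : 8 * m * Real.sqrt (d / (2 * c : ℕ)) +
      Real.sqrt 2 * Real.exp (-((2 * m * a : ℕ) ^ 2 / (4 * (2 * c : ℕ)))) < 1 / (2 * 3 ^ d))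
    (b : Finset (Fin (2 * c)) → ℝ) (hb : ∀ S, ¬(1 ≤ S.card ∧ S.card ≤ d) → b S = 0) :
    ∃ x, ∃ j ≤ a, (count x = c + m * j ∨ count x = c - m * j) ∧
      ∑ S, b S * permAverage S x ≤ 0 := by
  by_contra! hcon
  simp_rw [← expansion_symmCoeff] at hcon
  set f := symmCoeff b with hf
  have hsum : 0 < ∑ S, f S ^ 2 := by
    refine (sum_nonneg fun _ _ => sq_nonneg _).lt_of_ne' fun h => ?_
    rw [sum_eq_zero_iff_of_nonneg fun _ _ => sq_nonneg _] at h
    obtain ⟨x, hx⟩ := exists_count_eq (n := 2 * c) (k := c) (by omega)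
    have h0 := hcon x 0 (Nat.zero_le a) (Or.inl (by simpa using hx))
    simp only [mem_univ, true_implies, pow_eq_zero_iff two_ne_zero] at h
    simp [expansion, h] at h0
  set s := (Real.sqrt (∑ S, f S ^ 2))⁻¹ with hs
  have hs0 : 0 < s := by positivity
  refine absurd (inv_le_of_pos_on_grid (d := d) hc hm hac (fun S => s * f S) ?_ ?_ ?_ ?_ ?_)
    (not_le.2 hbound)
  · rw [hf, symmCoeff_eq_zero fun T hT => hb T (by simp at hT; simp [hT]), mul_zero]
  · intro S hS
    rw [hf, symmCoeff_eq_zero fun T hT => hb T (by omega), mul_zero]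
  · simp_rw [mul_pow, ← mul_sum]
    rw [hs, inv_pow, Real.sq_sqrt hsum.le, inv_mul_cancel₀ hsum.ne']
  · intro x x' h
    rw [expansion_smul, expansion_smul, hf, expansion_symmCoeff, expansion_symmCoeff]
    simp_rw [permAverage_eq_of_count_eq _ h]
  · intro x j hj hx
    rw [expansion_smul]
    exact mul_pos hs0 (hcon x j hj hx)

end BoolCube

open BoolCube in
/-- the "column repair" distribution κ: appending z ∼ κ to a balanced string y and
randomly permuting the coordinates makes all moments of order up to t-1 vanish. -/
theorem stmt9 :
    ∃ h₁ h₂ : ℝ, 0 < h₁ ∧ 0 < h₂ ∧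
      ∀ (t l a r : ℕ), 0 < t → 0 < l → 0 < a → 0 < r →
        2 ∣ l → a * l ≤ r →
        (h₁ * Real.sqrt ((t : ℝ) * (r : ℝ)) < (a * l : ℕ)) →
        (((t : ℝ) - 1) * (l : ℝ) * (2 : ℝ) ^ (h₂ * (t : ℝ)) ≤ Real.sqrt (r : ℝ)) →
        ∀ y : Fin (r - a * l) → Bool,
          -- y is perfectly balanced
          2 * (Finset.univ.filter fun i => y i = true).card = r - a * l →
          ∃ κ : (Fin (a * l) → Bool) → ℝ,
            IsDist κ ∧
            -- κ is supported on strings whose number of +1 entries is a multiple of l/2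
            (∀ z : Fin (a * l) → Bool, κ z ≠ 0 →
              (l / 2) ∣ (Finset.univ.filter fun j => z j = true).card) ∧
            -- all moments of order between 1 and t-1 of the permuted concatenation vanish
            (∀ S : Finset (Fin r), 1 ≤ S.card → S.card ≤ t - 1 →
              ∑ z : Fin (a * l) → Bool, κ z *
                ((∑ π : Equiv.Perm (Fin r), ∏ i ∈ S,
                    sgn ((fun j : Fin r =>
                      if h : (j : ℕ) < a * l then z ⟨(j : ℕ), h⟩
                      else y ⟨(j : ℕ) - a * l, by have hj := j.isLt; omega⟩) (π i)))
                  / (Fintype.card (Equiv.Perm (Fin r)) : ℝ)) = 0) := by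
  refine ⟨4, 4, by norm_num, by norm_num, ?_⟩
  rintro t l a r ht hl - hr ⟨m, rfl⟩ hle h1 h2 y hy
  have hal : a * (2 * m) = 2 * (m * a) := by ring
  obtain ⟨c, rfl⟩ : ∃ c, r = 2 * c := ⟨count y + m * a, by rw [count]; omega⟩
  have hm : 0 < m := by omega
  have hac : m * a ≤ c := by omega
  have hdiv : 2 * m / 2 = m := by omega
  have hyc : count y = c - m * a := by rw [count]; omega
  rw [show a * (2 * m) = 2 * m * a by ring] at h1
  have hbound := numeric_bound (a := a) ht (by omega) h1 h2
  set W : (Fin (a * (2 * m)) → Bool) → Fin (2 * c) → Bool := fun z j =>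
    if h : (j : ℕ) < a * (2 * m) then z ⟨(j : ℕ), h⟩
    else y ⟨(j : ℕ) - a * (2 * m), by have hj := j.isLt; omega⟩
  have hcount : ∀ z, count (W z) = count z + (c - m * a) := fun z => by
    rw [← hyc]; exact count_append hle z y
  rcases exists_weights_or_exists_functional
    (fun (z : {z : Fin (a * (2 * m)) → Bool // m ∣ count z}) (S : Finset (Fin (2 * c))) =>
      if 1 ≤ S.card ∧ S.card ≤ t - 1 then permAverage S (W z.1) else 0) with ⟨w, hw0, hw1, hw⟩ | ⟨b, hb⟩
  · have hsum : ∀ g : (Fin (a * (2 * m)) → Bool) → ℝ,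
        ∑ z, (∑ i : {z : Fin (a * (2 * m)) → Bool // m ∣ count z},
          if i.1 = z then w i else 0) * g z = ∑ i, w i * g i.1 := by
      intro g
      simp_rw [sum_mul, ite_mul, zero_mul]
      rw [sum_comm]
      simp
    refine ⟨fun z => ∑ i : {z : Fin (a * (2 * m)) → Bool // m ∣ count z},
      if i.1 = z then w i else 0, ⟨fun z => ?_, ?_⟩, fun z hz => ?_, fun S hS1 hS2 => ?_⟩
    · exact sum_nonneg fun i _ => by split_ifs <;> simp [hw0]
    · simpa [hw1] using hsum fun _ => 1
    · obtain ⟨i, -, hi⟩ := exists_ne_zero_of_sum_ne_zero hz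
      rw [hdiv]
      have : i.1 = z := by by_contra h; simp [h] at hi
      exact this ▸ i.2
    · have hwS := hw S
      simp only [hS1, hS2, and_self, if_true] at hwS
      exact (hsum fun z => permAverage S (W z)).trans hwS
  · exfalso
    obtain ⟨x, j, hj, hx, hle0⟩ := exists_layer_nonpos (by omega) hm hac hbound
      (fun S => if 1 ≤ S.card ∧ S.card ≤ t - 1 then b S else 0)
      fun S hS => if_neg hS
    have hmj := Nat.mul_le_mul_left m hj
    obtain ⟨z, hzdvd, hzx⟩ : ∃ z, m ∣ count z ∧ count (W z) = count x := by
      rcases hx with hx | hx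
      · obtain ⟨z, hz⟩ := exists_count_eq (n := a * (2 * m)) (k := m * a + m * j) (by omega)
        exact ⟨z, hz ▸ ⟨a + j, by ring⟩, by rw [hcount]; omega⟩
      · obtain ⟨z, hz⟩ := exists_count_eq (n := a * (2 * m)) (k := m * a - m * j) (by omega)
        exact ⟨z, hz ▸ ⟨a - j, by rw [Nat.mul_sub]⟩, by rw [hcount]; omega⟩
    refine absurd hle0 (not_le.2 ?_)
    refine (hb ⟨z, hzdvd⟩).trans_eq ?_
    simp_rw [ite_mul, mul_ite, zero_mul, mul_zero, permAverage_eq_of_count_eq _ hzx]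
end

section
/- For every constant ε of the form 1/(4c) with c > 0 an even integer, there is a probability distribution on n-vertex Max-Bisection instances such that, with probability 1 − o(1) over the choice of instance, both of the following hold: (1) there is a degree-Ω(n) pseudoexpectation over {±1}-valued vertex variables that satisfies x_v^2 = 1 for every vertex, satisfies the bisection identity Σ_v x_v = 0 with pseudovariance zero, and satisfies with pseudovariance zero the identity that the fraction of cut edges equals 3/4 − ε; (2) every genuine bisection cuts at most a (11/16 + ε) fraction of the edges. In particular, degree-o(n) Sum-of-Squares does not deliver a factor-(11/12 + ε) approximation for Max-Bisection. -/
open MvPolynomial Finset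

/-- Probability of an event under the uniform distribution on a finite sample space. -/
noncomputable def uprob {Ω : Type} [Fintype Ω] (p : Ω → Prop) : ℝ :=
  letI := Classical.decPred p
  ((Finset.univ.filter p).card : ℝ) / (Fintype.card Ω : ℝ)

/-- A distribution `μ` on `ι → Bool` is `j`-wise uniform: its marginal on every set of at most
`j` coordinates is uniform. -/
def kwiseUniform {ι : Type} [Fintype ι] [DecidableEq ι] (j : ℕ) (μ : (ι → Bool) → ℝ) : Prop :=
  ∀ A : Finset ι, A.card ≤ j → ∀ a : ι → Bool,
    ∑ x ∈ Finset.univ.filter (fun x : ι → Bool => ∀ i ∈ A, x i = a i), μ x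
      = (1 / 2 : ℝ) ^ A.card

/-- A degree-`d` pseudoexpectation over `{±1}`-valued variables `x_1, …, x_n`. -/
structure PEpm (n d : ℕ) where
  pE : MvPolynomial (Fin n) ℝ →ₗ[ℝ] ℝ
  normalized : pE 1 = 1
  multilin : ∀ p q : MvPolynomial (Fin n) ℝ,
    (∀ x : Fin n → Bool,
        MvPolynomial.eval (fun i => sgn (x i)) p = MvPolynomial.eval (fun i => sgn (x i)) q) →
      pE p = pE q
  psd : ∀ p : MvPolynomial (Fin n) ℝ, 2 * p.totalDegree ≤ d → 0 ≤ pE (p ^ 2)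

/-- The pseudoexpectation satisfies the identity `Q = b` with pseudovariance zero. -/
def PEpm.satEq {n d : ℕ} (E : PEpm n d) (Q : MvPolynomial (Fin n) ℝ) (b : ℝ) : Prop :=
  E.pE Q = b ∧ E.pE (Q ^ 2) = b ^ 2

/-- The multilinear arithmetization (in ±1 variables) of the 0/1-indicator of `x_S = a`. -/
noncomputable def indPM {n : ℕ} {ι : Type} [Fintype ι] (S : ι → Fin n) (a : ι → Bool) :
    MvPolynomial (Fin n) ℝ :=
  ∏ i, (MvPolynomial.C (1 / 2 : ℝ) * (1 + MvPolynomial.C (sgn (a i)) * MvPolynomial.X (S i)))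

/-- The arithmetization of the 0/1-indicator of the constraint "`P`, applied to the ±1 variables
of the scope `S` with signs flipped according to `z`, equals 1". -/
noncomputable def consPolyPM {n k : ℕ} (P : (Fin k → Bool) → Bool)
    (S : Fin k → Fin n) (z : Fin k → Bool) : MvPolynomial (Fin n) ℝ :=
  ∑ a ∈ Finset.univ.filter
      (fun a : Fin k → Bool => P (fun i => Bool.xor (a i) (z i)) = true),
    indPM S a

set_option linter.unusedSectionVars false

section FourierCube

variable {V : Type} [Fintype V] [DecidableEq V]

lemma sgn_mul_self (b : Bool) : sgn b * sgn b = 1 := by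
  cases b <;> simp [sgn]

lemma sum_sgn : ∑ b : Bool, sgn b = 0 := by
  simp [sgn]

/-- The character of the cube attached to a set of coordinates. -/
noncomputable def chi (S : Finset V) (x : V → Bool) : ℝ := ∏ v ∈ S, sgn (x v)

@[simp] lemma chi_empty (x : V → Bool) : chi ∅ x = 1 := by simp [chi]

lemma chi_singleton (v : V) (x : V → Bool) : chi {v} x = sgn (x v) := by simp [chi]

lemma chi_mul_self (S : Finset V) (x : V → Bool) : chi S x * chi S x = 1 := by
  simp [chi, ← Finset.prod_mul_distrib, sgn_mul_self]

lemma chi_mul_chi (S T : Finset V) (x : V → Bool) :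
    chi S x * chi T x = chi (symmDiff S T) x := by
  have hS : chi S x = chi (S \ T) x * chi (S ∩ T) x := by
    rw [chi, chi, chi, mul_comm, Finset.prod_inter_mul_prod_sdiff]
  have hT : chi T x = chi (T \ S) x * chi (S ∩ T) x := by
    rw [chi, chi, chi, mul_comm, Finset.inter_comm, Finset.prod_inter_mul_prod_sdiff]
  have hST : chi (symmDiff S T) x = chi (S \ T) x * chi (T \ S) x := by
    rw [chi, chi, chi, symmDiff_def, Finset.sup_eq_union, Finset.prod_union]
    exact disjoint_sdiff_sdiff
  rw [hS, hT, hST]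
  linear_combination (chi (S \ T) x * chi (T \ S) x) * chi_mul_self (S ∩ T) x

lemma sum_chi (S : Finset V) :
    ∑ x : V → Bool, chi S x = if S = ∅ then (2 : ℝ) ^ Fintype.card V else 0 := by
  have key : ∑ x : V → Bool, chi S x = ∏ v : V, ∑ b : Bool, (if v ∈ S then sgn b else 1) := by
    rw [Finset.prod_univ_sum, Fintype.piFinset_univ]
    refine Finset.sum_congr rfl fun x _ => ?_
    rw [chi, Finset.prod_ite_mem, Finset.univ_inter]
  rw [key]
  split_ifs with h
  · subst h
    simp
  · obtain ⟨v, hv⟩ := Finset.nonempty_iff_ne_empty.mpr h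
    exact Finset.prod_eq_zero (Finset.mem_univ v) (by simp [hv, sgn])

lemma card_symmDiff_le (S T : Finset V) : (symmDiff S T).card ≤ S.card + T.card := by
  rw [symmDiff_def, Finset.sup_eq_union]
  exact (Finset.card_union_le _ _).trans
    (add_le_add (Finset.card_le_card Finset.sdiff_subset)
      (Finset.card_le_card Finset.sdiff_subset))

/-- The functions on the cube of degree at most `h`. -/
def lowDeg (V : Type) [Fintype V] [DecidableEq V] (h : ℕ) : Submodule ℝ ((V → Bool) → ℝ) :=
  Submodule.span ℝ (Set.range fun S : {S : Finset V // S.card ≤ h} => chi S.1)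

lemma chi_mem_lowDeg {h : ℕ} {S : Finset V} (hS : S.card ≤ h) : chi S ∈ lowDeg V h :=
  Submodule.subset_span ⟨⟨S, hS⟩, rfl⟩

lemma lowDeg_mono {a b : ℕ} (hab : a ≤ b) : lowDeg V a ≤ lowDeg V b := by
  refine Submodule.span_le.mpr ?_
  rintro _ ⟨S, rfl⟩
  exact chi_mem_lowDeg (S.2.trans hab)

lemma const_mem_lowDeg (r : ℝ) (h : ℕ) : (fun _ => r) ∈ lowDeg V h := by
  have h1 : (fun _ => r) = r • (chi (∅ : Finset V)) := by
    ext x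
    simp
  rw [h1]
  exact Submodule.smul_mem _ _ (chi_mem_lowDeg (by simp))

lemma coord_mem_lowDeg (v : V) : (fun x : V → Bool => sgn (x v)) ∈ lowDeg V 1 := by
  have h1 : (fun x : V → Bool => sgn (x v)) = chi {v} := by
    ext x
    rw [chi_singleton]
  rw [h1]
  exact chi_mem_lowDeg (by simp)

lemma mul_mem_lowDeg {a b : ℕ} {f g : (V → Bool) → ℝ} (hf : f ∈ lowDeg V a)
    (hg : g ∈ lowDeg V b) : f * g ∈ lowDeg V (a + b) := by
  induction hf using Submodule.span_induction with
  | mem f hf =>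
    obtain ⟨S, rfl⟩ := hf
    induction hg using Submodule.span_induction with
    | mem g hg =>
      obtain ⟨T, rfl⟩ := hg
      have : chi S.1 * chi T.1 = chi (symmDiff S.1 T.1) := by
        ext x
        exact chi_mul_chi _ _ _
      simp only [this]
      exact chi_mem_lowDeg ((card_symmDiff_le _ _).trans (add_le_add S.2 T.2))
    | zero => simp
    | add g g' _ _ h h' => rw [mul_add]; exact Submodule.add_mem _ h h'
    | smul r g _ h => rw [mul_smul_comm]; exact Submodule.smul_mem _ _ h
  | zero => simp
  | add f f' _ _ h h' => rw [add_mul]; exact Submodule.add_mem _ h h'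
  | smul r f _ h => rw [smul_mul_assoc]; exact Submodule.smul_mem _ _ h

lemma pow_mem_lowDeg {a : ℕ} {f : (V → Bool) → ℝ} (hf : f ∈ lowDeg V a) (k : ℕ) :
    f ^ k ∈ lowDeg V (a * k) := by
  induction k with
  | zero => exact const_mem_lowDeg 1 _
  | succ k ih => rw [pow_succ]; exact mul_mem_lowDeg ih hf

lemma prod_mem_lowDeg {ι : Type} (s : Finset ι) {a : ι → ℕ} {f : ι → (V → Bool) → ℝ}
    (hf : ∀ i ∈ s, f i ∈ lowDeg V (a i)) : ∏ i ∈ s, f i ∈ lowDeg V (∑ i ∈ s, a i) := by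
  classical
  induction s using Finset.induction_on with
  | empty => exact const_mem_lowDeg 1 _
  | insert i s hi ih =>
    rw [Finset.prod_insert hi, Finset.sum_insert hi]
    exact mul_mem_lowDeg (hf i (Finset.mem_insert_self i s))
      (ih fun j hj => hf j (Finset.mem_insert_of_mem hj))

lemma sum_lowDeg_mul_chi {h : ℕ} {f : (V → Bool) → ℝ} (hf : f ∈ lowDeg V h) {S : Finset V}
    (hS : h < S.card) : ∑ x, f x * chi S x = 0 := by
  induction hf using Submodule.span_induction with
  | mem f hf =>
    obtain ⟨T, rfl⟩ := hf
    have hne : symmDiff T.1 S ≠ ∅ := by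
      intro h0
      have : T.1 = S := symmDiff_eq_bot.mp h0
      have := T.2
      simp_all
      omega
    simp_rw [chi_mul_chi, sum_chi, if_neg hne]
  | zero => simp
  | add f f' _ _ h h' => simp [add_mul, Finset.sum_add_distrib, h, h']
  | smul r f _ h => simp [mul_assoc, ← Finset.mul_sum, h]

/-- Substituting functions of degree at most `a` into a polynomial of total degree `k` gives a
function of degree at most `a * k`. -/
lemma eval_mem_lowDeg {σ : Type} [Fintype σ] {a : ℕ} {φ : σ → (V → Bool) → ℝ}
    (hφ : ∀ s, φ s ∈ lowDeg V a) (p : MvPolynomial σ ℝ) :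
    (fun x => MvPolynomial.eval (fun s => φ s x) p) ∈ lowDeg V (a * p.totalDegree) := by
  have h1 : (fun x => MvPolynomial.eval (fun s => φ s x) p)
      = ∑ d ∈ p.support, p.coeff d • ∏ s, φ s ^ d s := by
    ext x
    simp [MvPolynomial.eval_eq', Finset.sum_apply, Finset.prod_apply]
  rw [h1]
  refine Submodule.sum_mem _ fun d hd => Submodule.smul_mem _ _ ?_
  refine lowDeg_mono ?_ (prod_mem_lowDeg Finset.univ fun s _ => pow_mem_lowDeg (hφ s) (d s))
  rw [← Finset.mul_sum]
  refine Nat.mul_le_mul_left a ?_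
  refine le_trans (le_of_eq ?_) (MvPolynomial.le_totalDegree hd)
  rw [Finsupp.sum_fintype]
  simp

end FourierCube

/-- A symmetric kernel that is multiplicative along its nonzero entries is positive
semidefinite. -/
lemma kernel_quadratic_nonneg {ι : Type} [Fintype ι] (g : ι → ι → ℝ)
    (hsymm : ∀ i j, g i j = g j i) (hone : ∀ i, g i i = 1)
    (hmul : ∀ i j k, g i j ≠ 0 → g i k = g i j * g j k) (p : ι → ℝ) :
    0 ≤ ∑ i, ∑ k, p i * p k * g i k := by
  set κ : ι → ℝ := fun j => ∑ i, g i j ^ 2 with hκ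
  have hsq : ∀ i j, g i j ≠ 0 → g i j ^ 2 = 1 := fun i j h => by
    rw [pow_two, ← hone i, hmul i j i h, hsymm j i]
  have hκ_pos : ∀ j, 0 < κ j := fun j =>
    Finset.sum_pos' (fun i _ => sq_nonneg _) ⟨j, Finset.mem_univ j, by simp [hone]⟩
  have hκ_eq : ∀ i j, g i j ≠ 0 → κ i = κ j := fun i j h => by
    refine Finset.sum_congr rfl fun l _ => ?_
    rw [hsymm l i, hmul i j l h, mul_pow, hsq i j h, one_mul, hsymm]
  have hκ_sum : ∀ i, ∑ j, g i j ^ 2 = κ i := fun i =>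
    Finset.sum_congr rfl fun j _ => by rw [hsymm]
  have hterm : ∀ i k, g i k = ∑ j, g i j * g k j / κ j := fun i k => by
    have : ∀ j, g i j * g k j / κ j = g i j ^ 2 * (g i k / κ i) := fun j => by
      by_cases h : g i j = 0
      · simp [h]
      · rw [hsq i j h, hκ_eq i j h, hmul i j k h, hsymm k j, one_mul]
    simp_rw [this]
    rw [← Finset.sum_mul, hκ_sum, mul_div_cancel₀ _ (hκ_pos i).ne']
  have hsum : ∑ i, ∑ k, p i * p k * g i k = ∑ j, (∑ i, p i * g i j) ^ 2 / κ j := by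
    simp_rw [pow_two, Finset.sum_mul_sum, Finset.sum_div]
    rw [Finset.sum_comm' (t' := Finset.univ) (s' := fun _ => Finset.univ) (by simp)]
    rw [Finset.sum_comm]
    rw [Finset.sum_comm (s := Finset.univ (α := ι)) (t := Finset.univ)
      (f := fun j i => ∑ k, p i * g i j * (p k * g k j) / κ j)]
    refine Finset.sum_congr rfl fun i _ => ?_
    rw [Finset.sum_comm]
    refine Finset.sum_congr rfl fun k _ => ?_
    rw [hterm i k, Finset.mul_sum]
    exact Finset.sum_congr rfl fun j _ => by ring
  rw [hsum]
  exact Finset.sum_nonneg fun j _ => div_nonneg (sq_nonneg _) (hκ_pos j).le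

section XorDensity

variable {V ι : Type} [Fintype V] [DecidableEq V] [Fintype ι] [DecidableEq ι]

/-- The coordinates contained in an odd number of the sets `E C`, `C ∈ T`. -/
def oddSet (E : ι → Finset V) (T : Finset ι) : Finset V :=
  Finset.univ.filter fun v => Odd (T.filter fun C => v ∈ E C).card

lemma oddSet_empty (E : ι → Finset V) : oddSet E ∅ = ∅ := by
  simp [oddSet]

lemma oddSet_insert (E : ι → Finset V) {C : ι} {T : Finset ι} (hC : C ∉ T) :
    oddSet E (insert C T) = symmDiff (oddSet E T) (E C) := by
  ext v
  simp only [oddSet, Finset.mem_filter, Finset.mem_univ, true_and, Finset.mem_symmDiff,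
    Finset.filter_insert]
  by_cases hv : v ∈ E C
  · rw [if_pos hv, Finset.card_insert_of_notMem (by simp [hC]), Nat.odd_add_one]
    simp [hv]
  · simp [hv]

/-- The product of the signed characters `β C * chi (E C)` over `C ∈ T`. -/
noncomputable def signedChi (E : ι → Finset V) (β : ι → ℝ) (T : Finset ι) (x : V → Bool) : ℝ :=
  ∏ C ∈ T, (β C * chi (E C) x)

lemma signedChi_eq (E : ι → Finset V) (β : ι → ℝ) (T : Finset ι) (x : V → Bool) :
    signedChi E β T x = (∏ C ∈ T, β C) * chi (oddSet E T) x := by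
  induction T using Finset.induction_on with
  | empty => simp [signedChi, oddSet_empty]
  | insert C T hC ih =>
    rw [signedChi] at ih ⊢
    rw [Finset.prod_insert hC, Finset.prod_insert hC, oddSet_insert E hC, ← chi_mul_chi, ih]
    ring

lemma signedChi_mul_singleton (E : ι → Finset V) {β : ι → ℝ} (hβ : ∀ C, β C * β C = 1)
    (T : Finset ι) (C : ι) (x : V → Bool) :
    signedChi E β T x * (β C * chi (E C) x) = signedChi E β (symmDiff T {C}) x := by
  have hsq : (β C * chi (E C) x) * (β C * chi (E C) x) = 1 := by
    linear_combination (chi (E C) x) ^ 2 * hβ C + chi_mul_self (E C) x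
  by_cases hC : C ∈ T
  · have h1 : symmDiff T {C} = T.erase C := by
      ext D
      by_cases h : D = C <;> simp [Finset.mem_symmDiff, h, hC]
    rw [h1, signedChi, signedChi, ← Finset.mul_prod_erase T _ hC]
    linear_combination (∏ D ∈ T.erase C, (β D * chi (E D) x)) * hsq
  · have h1 : symmDiff T {C} = insert C T := by
      ext D
      by_cases h : D = C <;> simp [Finset.mem_symmDiff, h, hC]
    rw [h1, signedChi, signedChi, Finset.prod_insert hC, mul_comm]

/-- The truncation at order `t` of the product of the factors `1 + β C * chi (E C)`. -/
noncomputable def xorDensity (E : ι → Finset V) (β : ι → ℝ) (t : ℕ) (x : V → Bool) : ℝ :=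
  ∑ T ∈ Finset.univ.filter (fun T : Finset ι => T.card ≤ t), signedChi E β T x

variable {E : ι → Finset V} {β : ι → ℝ} {t : ℕ}

lemma signedChi_mem_lowDeg (hE : ∀ C, (E C).card ≤ 4) (T : Finset ι) :
    signedChi E β T ∈ lowDeg V (4 * T.card) := by
  have h1 : signedChi E β T = ∏ C ∈ T, β C • chi (E C) := by
    ext x
    simp [signedChi, Finset.prod_apply]
  rw [h1]
  have := prod_mem_lowDeg (V := V) T (a := fun _ => 4) (f := fun C => β C • chi (E C))
    fun C _ => Submodule.smul_mem _ _ (chi_mem_lowDeg (hE C))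
  simpa [mul_comm] using this

lemma sum_lowDeg_mul_signedChi
    (hexp : ∀ T : Finset ι, T.Nonempty → T.card ≤ t + 1 → T.card ≤ (oddSet E T).card)
    {a : ℕ} {f : (V → Bool) → ℝ} (hf : f ∈ lowDeg V a) {T : Finset ι} (hT : a < T.card)
    (hT' : T.card ≤ t + 1) : ∑ x, f x * signedChi E β T x = 0 := by
  have h1 := hexp T (Finset.card_pos.mp (by omega)) hT'
  have h2 := sum_lowDeg_mul_chi hf (hT.trans_le h1)
  have h3 : ∀ x, f x * signedChi E β T x = (∏ C ∈ T, β C) * (f x * chi (oddSet E T) x) :=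
    fun x => by rw [signedChi_eq]; ring
  simp_rw [h3]
  rw [← Finset.mul_sum, h2, mul_zero]

lemma sum_xorDensity
    (hexp : ∀ T : Finset ι, T.Nonempty → T.card ≤ t + 1 → T.card ≤ (oddSet E T).card) :
    ∑ x, xorDensity E β t x = (2 : ℝ) ^ Fintype.card V := by
  simp_rw [xorDensity]
  rw [Finset.sum_comm, Finset.sum_eq_single ∅]
  · simp [signedChi]
  · intro T hT hne
    have hpos : 0 < T.card := Finset.card_pos.mpr (Finset.nonempty_iff_ne_empty.mpr hne)
    have hle : T.card ≤ t := by simpa using hT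
    simpa using sum_lowDeg_mul_signedChi (β := β) hexp (const_mem_lowDeg 1 0) hpos
      (by omega : T.card ≤ t + 1)
  · simp

/-- The density `xorDensity` annihilates the low-degree multiples of `1 - β C * chi (E C)`. -/
lemma sum_mul_one_sub_mul_xorDensity (hβ : ∀ C, β C * β C = 1)
    (hexp : ∀ T : Finset ι, T.Nonempty → T.card ≤ t + 1 → T.card ≤ (oddSet E T).card)
    {a : ℕ} (hat : a < t) {f : (V → Bool) → ℝ} (hf : f ∈ lowDeg V a) (C : ι) :
    ∑ x, f x * (1 - β C * chi (E C) x) * xorDensity E β t x = 0 := by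
  set A : Finset ι → ℝ := fun T => ∑ x, f x * signedChi E β T x with hA
  set B : Finset ι → ℝ := fun T => if T.card ≤ t then A T else 0 with hB
  have hA0 : ∀ T : Finset ι, t ≤ T.card → T.card ≤ t + 1 → A T = 0 := fun T h h' =>
    sum_lowDeg_mul_signedChi hexp hf (hat.trans_le h) h'
  have hcard : ∀ T : Finset ι, (symmDiff T {C}).card ≤ T.card + 1 := fun T => by
    simpa using card_symmDiff_le T {C}
  have hinv : ∀ T : Finset ι, symmDiff (symmDiff T {C}) {C} = T := fun T =>
    symmDiff_symmDiff_cancel_right {C} T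
  have hB' : ∀ T, B (symmDiff T {C}) = if T.card ≤ t then A (symmDiff T {C}) else 0 := by
    intro T
    have h1 := hcard T
    have h2 := hcard (symmDiff T {C})
    rw [hinv] at h2
    simp only [hB]
    split_ifs with h3 h4 h4
    · rfl
    · exact hA0 _ (by omega) (by omega)
    · exact (hA0 _ (by omega) (by omega)).symm
    · rfl
  have hsum : ∑ T, B (symmDiff T {C}) = ∑ T, B T :=
    Fintype.sum_bijective (fun T : Finset ι => symmDiff T {C})
      (Function.Involutive.bijective hinv) _ _ fun _ => rfl
  have hmain : ∑ x, f x * (1 - β C * chi (E C) x) * xorDensity E β t x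
      = ∑ T, B T - ∑ T, B (symmDiff T {C}) := by
    simp_rw [hB']
    simp only [hB]
    rw [← Finset.sum_filter, ← Finset.sum_filter, ← Finset.sum_sub_distrib]
    simp only [hA, ← Finset.sum_sub_distrib, xorDensity, Finset.mul_sum]
    rw [Finset.sum_comm]
    refine Finset.sum_congr rfl fun T _ => Finset.sum_congr rfl fun x _ => ?_
    rw [← signedChi_mul_singleton E hβ]
    ring
  rw [hmain, hsum, sub_self]

lemma sum_mul_signedChi_mul_xorDensity (hβ : ∀ C, β C * β C = 1) (hE : ∀ C, (E C).card ≤ 4)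
    (hexp : ∀ T : Finset ι, T.Nonempty → T.card ≤ t + 1 → T.card ≤ (oddSet E T).card)
    {a : ℕ} {f : (V → Bool) → ℝ} (hf : f ∈ lowDeg V a) (T : Finset ι)
    (hT : a + 4 * T.card < t) :
    ∑ x, f x * signedChi E β T x * xorDensity E β t x = ∑ x, f x * xorDensity E β t x := by
  induction T using Finset.induction_on with
  | empty => simp [signedChi]
  | insert C T hC ih =>
    rw [Finset.card_insert_of_notMem hC] at hT
    rw [← ih (by omega)]
    have h1 := sum_mul_one_sub_mul_xorDensity hβ hexp (a := a + 4 * T.card) (by omega)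
      (mul_mem_lowDeg hf (signedChi_mem_lowDeg (β := β) hE T)) C
    rw [← sub_eq_zero, ← neg_eq_zero, ← h1, ← Finset.sum_sub_distrib, ← Finset.sum_neg_distrib]
    refine Finset.sum_congr rfl fun x _ => ?_
    rw [signedChi, Finset.prod_insert hC, signedChi, Pi.mul_apply, signedChi]
    ring

/-- The density `xorDensity` is nonnegative on squares of low-degree functions. -/
lemma sum_sq_mul_xorDensity_nonneg (hβ : ∀ C, β C * β C = 1) (hE : ∀ C, (E C).card ≤ 4)
    (hexp : ∀ T : Finset ι, T.Nonempty → T.card ≤ t + 1 → T.card ≤ (oddSet E T).card)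
    {h : ℕ} (hh : 10 * h < t) {f : (V → Bool) → ℝ} (hf : f ∈ lowDeg V h) :
    0 ≤ ∑ x, f x ^ 2 * xorDensity E β t x := by
  obtain ⟨p, rfl⟩ := (Submodule.mem_span_range_iff_exists_fun ℝ).mp hf
  set M : ℝ := (2 : ℝ) ^ Fintype.card V with hM
  have hM0 : 0 < M := by positivity
  set g : {S : Finset V // S.card ≤ h} → {S : Finset V // S.card ≤ h} → ℝ := fun S S' =>
    (∑ x, chi S.1 x * chi S'.1 x * xorDensity E β t x) / M with hg
  have hmem : ∀ S S' : {S : Finset V // S.card ≤ h},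
      (fun x => chi S.1 x * chi S'.1 x) ∈ lowDeg V (2 * h) := fun S S' => by
    rw [two_mul]
    exact mul_mem_lowDeg (chi_mem_lowDeg S.2) (chi_mem_lowDeg S'.2)
  have hsymm : ∀ S S', g S S' = g S' S := fun S S' => by
    simp only [hg]
    congr 1
    exact Finset.sum_congr rfl fun x _ => by ring
  have hone : ∀ S, g S S = 1 := fun S => by
    simp only [hg, chi_mul_self, one_mul]
    rw [sum_xorDensity hexp, div_self hM0.ne']
  have hmul : ∀ S S' S'', g S S' ≠ 0 → g S S'' = g S S' * g S' S'' := by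
    intro S S' S'' hne
    have hex : ∃ T : Finset ι, T.card ≤ t ∧
        ∑ x, (chi S.1 x * chi S'.1 x) * signedChi E β T x ≠ 0 := by
      by_contra hcon
      push Not at hcon
      refine hne ?_
      simp only [hg, xorDensity, Finset.mul_sum]
      rw [Finset.sum_comm, Finset.sum_eq_zero, zero_div]
      intro T hT
      exact hcon T (by simpa using hT)
    obtain ⟨T, hTt, hT⟩ := hex
    have hTh : T.card ≤ 2 * h := by
      by_contra hcon
      exact hT (sum_lowDeg_mul_signedChi hexp (hmem S S') (by omega) (by omega))
    obtain ⟨r, hr⟩ : ∃ r : ℝ, ∀ x, chi S.1 x * chi S'.1 x = r * signedChi E β T x := by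
      refine ⟨∏ C ∈ T, β C, fun x => ?_⟩
      have hEq : symmDiff S.1 S'.1 = oddSet E T := by
        by_contra hcon
        refine hT ?_
        have hne : symmDiff (symmDiff S.1 S'.1) (oddSet E T) ≠ ∅ := fun h0 =>
          hcon (symmDiff_eq_bot.mp h0)
        have h3 : ∀ x, chi S.1 x * chi S'.1 x * signedChi E β T x = (∏ C ∈ T, β C) *
            chi (symmDiff (symmDiff S.1 S'.1) (oddSet E T)) x := fun x => by
          rw [signedChi_eq, ← chi_mul_chi, ← chi_mul_chi]
          ring
        simp_rw [h3]
        rw [← Finset.mul_sum, sum_chi, if_neg hne, mul_zero]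
      rw [chi_mul_chi, hEq, signedChi_eq, ← mul_assoc, ← Finset.prod_mul_distrib]
      simp [hβ]
    have h1 : g S S' = r := by
      have h2 := sum_mul_signedChi_mul_xorDensity hβ hE hexp
        (const_mem_lowDeg (V := V) r 0) T (by omega)
      simp only [hg, hr]
      rw [h2, ← Finset.mul_sum, sum_xorDensity hexp, mul_div_assoc, div_self hM0.ne', mul_one]
    have h3 := sum_mul_signedChi_mul_xorDensity hβ hE hexp (hmem S' S'') T (by omega)
    rw [h1]
    simp only [hg]
    rw [← mul_div_assoc, ← h3, Finset.mul_sum]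
    congr 1
    refine Finset.sum_congr rfl fun x _ => ?_
    linear_combination (chi S'.1 x * chi S''.1 x * xorDensity E β t x) * hr x
      - (chi S.1 x * chi S''.1 x * xorDensity E β t x) * chi_mul_self S'.1 x
  have hfinal := kernel_quadratic_nonneg g hsymm hone hmul p
  have hexpand : ∑ x, (∑ S, p S • chi S.1) x ^ 2 * xorDensity E β t x
      = M * ∑ S, ∑ S', p S * p S' * g S S' := by
    simp only [hg, Finset.sum_apply, Pi.smul_apply, smul_eq_mul, pow_two, Finset.sum_mul_sum]
    simp_rw [Finset.sum_mul, Finset.mul_sum]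
    rw [Finset.sum_comm]
    refine Finset.sum_congr rfl fun S _ => ?_
    rw [Finset.sum_comm]
    refine Finset.sum_congr rfl fun S' _ => ?_
    rw [← mul_div_assoc, mul_div_cancel₀ _ hM0.ne', Finset.mul_sum]
    exact Finset.sum_congr rfl fun x _ => by ring
  rw [hexpand]
  exact mul_nonneg hM0.le hfinal

end XorDensity

section RandomInstance

/-- The multilinear polynomial that agrees with `|t 0 + t 1 + t 2 + t 3|` on sign vectors. -/
noncomputable def absSumPoly (t : Fin 4 → ℝ) : ℝ :=
  3 / 2 + (t 0 * t 1 + t 0 * t 2 + t 0 * t 3 + t 1 * t 2 + t 1 * t 3 + t 2 * t 3) / 2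
    - t 0 * t 1 * t 2 * t 3 / 2

lemma abs_sum_sgn (b : Fin 4 → Bool) : |∑ j, sgn (b j)| = absSumPoly fun j => sgn (b j) := by
  rw [absSumPoly, Fin.sum_univ_four]
  cases b 0 <;> cases b 1 <;> cases b 2 <;> cases b 3 <;> norm_num [sgn]

lemma absSumPoly_le {t : Fin 4 → ℝ} (ht : ∀ j, |t j| ≤ 1) :
    absSumPoly t ≤ 3 / 2 + (∑ j, t j) ^ 2 / 4 := by
  have h1 : -(t 0 * t 1 * t 2 * t 3) ≤ (t 0 ^ 2 + t 1 ^ 2) / 2 := by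
    have h2 : |t 2 * t 3| ≤ 1 := by
      rw [abs_mul]
      exact mul_le_one₀ (ht 2) (abs_nonneg _) (ht 3)
    have h3 : |t 0 * t 1| ≤ (t 0 ^ 2 + t 1 ^ 2) / 2 := by
      rw [abs_le]
      constructor <;> nlinarith [sq_nonneg (t 0 + t 1), sq_nonneg (t 0 - t 1)]
    calc -(t 0 * t 1 * t 2 * t 3) ≤ |t 0 * t 1 * t 2 * t 3| := neg_le_abs _
      _ = |t 0 * t 1| * |t 2 * t 3| := by rw [← abs_mul]; ring_nf
      _ ≤ |t 0 * t 1| * 1 := by gcongr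
      _ ≤ _ := by rw [mul_one]; exact h3
  rw [absSumPoly, Fin.sum_univ_four]
  nlinarith [sq_nonneg (t 2), sq_nonneg (t 3)]

lemma sum_prod_apply {A : Type} [Fintype A] (g : Fin 4 → A → ℝ) :
    ∑ a : Fin 4 → A, g 0 (a 0) * g 1 (a 1) * g 2 (a 2) * g 3 (a 3)
      = (∑ a, g 0 a) * (∑ a, g 1 a) * (∑ a, g 2 a) * ∑ a, g 3 a := by
  have h := Finset.prod_univ_sum (fun _ : Fin 4 => (Finset.univ : Finset A)) g
  rw [Fintype.piFinset_univ] at h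
  simpa [Fin.prod_univ_four] using h.symm

/-- Averaging commutes with the multilinear polynomial `absSumPoly`. -/
lemma sum_absSumPoly {A : Type} [Fintype A] [Nonempty A] (g : Fin 4 → A → ℝ) :
    ∑ a : Fin 4 → A, absSumPoly (fun j => g j (a j))
      = (Fintype.card A : ℝ) ^ 4 * absSumPoly fun j => (∑ a, g j a) / Fintype.card A := by
  have hA : (Fintype.card A : ℝ) ≠ 0 := by positivity
  have h01 := sum_prod_apply ![g 0, g 1, fun _ => 1, fun _ => 1]
  have h02 := sum_prod_apply ![g 0, fun _ => 1, g 2, fun _ => 1]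
  have h03 := sum_prod_apply ![g 0, fun _ => 1, fun _ => 1, g 3]
  have h12 := sum_prod_apply ![fun _ => 1, g 1, g 2, fun _ => 1]
  have h13 := sum_prod_apply ![fun _ => 1, g 1, fun _ => 1, g 3]
  have h23 := sum_prod_apply ![fun _ => 1, fun _ => 1, g 2, g 3]
  have h4 := sum_prod_apply g
  simp only [Matrix.cons_val, mul_one, one_mul, Finset.sum_const, Finset.card_univ,
    nsmul_eq_mul] at h01 h02 h03 h12 h13 h23
  simp only [absSumPoly, Finset.sum_sub_distrib, Finset.sum_add_distrib, ← Finset.sum_div,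
    h01, h02, h03, h12, h13, h23, h4, Finset.sum_const, Finset.card_univ, nsmul_eq_mul,
    Fintype.card_fun, Fintype.card_fin, Nat.cast_pow]
  field_simp

/-- An exponential tail bound for sums of independent, uniformly distributed terms. -/
lemma card_filter_le_sum_le {Λ : Type} [Fintype Λ] [Nonempty Λ] (m : ℕ) (f : Λ → ℝ)
    (hf : ∀ a, |f a| ≤ 4) (hsum : ∑ a, f a = 0) {η : ℝ} (hη : 0 < η) (hη' : η ≤ 8) :
    ((Finset.univ.filter fun ω : Fin m → Λ => η * m ≤ ∑ C, f (ω C)).card : ℝ)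
      ≤ (Fintype.card (Fin m → Λ) : ℝ) * Real.exp (-(m * η ^ 2 / 64)) := by
  set l : ℝ := η / 32 with hl
  have hl0 : 0 < l := by positivity
  have hbase : ∑ a, Real.exp (l * f a) ≤ Fintype.card Λ * Real.exp (16 * l ^ 2) := by
    have h1 : ∀ a, Real.exp (l * f a) ≤ 1 + l * f a + 16 * l ^ 2 := fun a => by
      have h2 : |l * f a| ≤ 1 := by
        rw [abs_mul, abs_of_pos hl0]
        nlinarith [hf a, abs_nonneg (f a)]
      have h3 := (abs_le.mp (Real.abs_exp_sub_one_sub_id_le h2)).2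
      have h4 : f a ^ 2 ≤ 16 := by
        have := sq_le_sq' (abs_le.mp (hf a)).1 (abs_le.mp (hf a)).2
        linarith
      nlinarith [sq_nonneg l]
    calc ∑ a, Real.exp (l * f a) ≤ ∑ a, (1 + l * f a + 16 * l ^ 2) :=
          Finset.sum_le_sum fun a _ => h1 a
      _ = Fintype.card Λ * (1 + 16 * l ^ 2) := by
          simp only [Finset.sum_add_distrib, ← Finset.mul_sum, hsum, Finset.sum_const,
            Finset.card_univ, nsmul_eq_mul]
          ring
      _ ≤ Fintype.card Λ * Real.exp (16 * l ^ 2) := by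
          gcongr
          linarith [Real.add_one_le_exp (16 * l ^ 2)]
  have htot : ∑ ω : Fin m → Λ, Real.exp (l * ∑ C, f (ω C))
      ≤ (Fintype.card (Fin m → Λ) : ℝ) * Real.exp (m * (16 * l ^ 2)) := by
    have h1 : ∑ ω : Fin m → Λ, Real.exp (l * ∑ C, f (ω C)) = (∑ a, Real.exp (l * f a)) ^ m := by
      have h := Finset.prod_univ_sum (fun _ : Fin m => (Finset.univ : Finset Λ))
        fun _ a => Real.exp (l * f a)
      rw [Fintype.piFinset_univ] at h
      simp only [Finset.prod_const, Finset.card_univ, Fintype.card_fin] at h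
      rw [h]
      exact Finset.sum_congr rfl fun ω _ => by rw [Finset.mul_sum, Real.exp_sum]
    rw [h1, Real.exp_nat_mul, Fintype.card_fun, Fintype.card_fin, Nat.cast_pow, ← mul_pow]
    exact pow_le_pow_left₀ (Finset.sum_nonneg fun _ _ => (Real.exp_pos _).le) hbase m
  have hmarkov : ((Finset.univ.filter fun ω : Fin m → Λ => η * m ≤ ∑ C, f (ω C)).card : ℝ)
      * Real.exp (l * (η * m)) ≤ ∑ ω : Fin m → Λ, Real.exp (l * ∑ C, f (ω C)) := by
    rw [← nsmul_eq_mul, ← Finset.sum_const]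
    refine (Finset.sum_le_sum fun ω hω => ?_).trans
      (Finset.sum_le_sum_of_subset_of_nonneg (Finset.filter_subset _ _)
        fun _ _ _ => (Real.exp_pos _).le)
    rw [Real.exp_le_exp]
    exact mul_le_mul_of_nonneg_left (Finset.mem_filter.mp hω).2 hl0.le
  rw [← le_div_iff₀ (Real.exp_pos _)] at hmarkov
  refine hmarkov.trans ((div_le_div_of_nonneg_right htot (Real.exp_pos _).le).trans
    (le_of_eq ?_))
  rw [mul_div_assoc, ← Real.exp_sub]
  congr 2
  rw [hl]
  ring

lemma sum_sum_update {ι A : Type} [Fintype ι] [DecidableEq ι] [Fintype A] (c : ι)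
    (G : (ι → A) → ℝ) :
    ∑ ω : ι → A, ∑ a, G (Function.update ω c a) = Fintype.card A * ∑ ω, G ω := by
  have hupd : ∀ (p : A × ({j // j ≠ c} → A)) (a : A),
      Function.update ((Equiv.funSplitAt c A).symm p) c a
        = (Equiv.funSplitAt c A).symm (a, p.2) := by
    intro p a
    ext j
    by_cases hj : j = c
    · subst hj
      simp
    · simp [hj]
  rw [← Equiv.sum_comp (Equiv.funSplitAt c A).symm, ← Equiv.sum_comp (Equiv.funSplitAt c A).symm]
  simp_rw [hupd]
  simp only [Fintype.sum_prod_type, Finset.sum_const, Finset.card_univ, nsmul_eq_mul]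
  rw [Finset.sum_comm]

variable {N : ℕ}

/-- The base variables read by a constraint, which consists of one literal from each of the four
groups of variables. -/
def scope (a : Fin 4 → Fin N × Bool) : Finset (Fin 4 × Fin N) :=
  Finset.univ.image fun j => (j, (a j).1)

lemma card_scope_le (a : Fin 4 → Fin N × Bool) : (scope a).card ≤ 4 := by
  exact Finset.card_image_le.trans (by simp)

/-- The members of `S` that belong to group `j`. -/
def group (S : Finset (Fin 4 × Fin N)) (j : Fin 4) : Finset (Fin N) :=
  Finset.univ.filter fun i => (j, i) ∈ S

lemma card_eq_sum_group (S : Finset (Fin 4 × Fin N)) : S.card = ∑ j, (group S j).card := by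
  rw [← Finset.card_sigma]
  refine Finset.card_bij (fun p _ => ⟨p.1, p.2⟩) ?_ ?_ ?_
  · rintro ⟨j, i⟩ h
    simpa [group] using h
  · rintro ⟨j, i⟩ _ ⟨j', i'⟩ _ h
    simpa using h
  · rintro ⟨j, i⟩ h
    exact ⟨(j, i), by simpa [group] using h, rfl⟩

lemma group_symmDiff_scope (S : Finset (Fin 4 × Fin N)) (a : Fin 4 → Fin N × Bool) (j : Fin 4) :
    group (symmDiff S (scope a)) j = symmDiff (group S j) {(a j).1} := by
  ext i
  simp [group, scope, Finset.mem_symmDiff, eq_comm]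

lemma sum_pow_card_symmDiff_singleton_le (S : Finset (Fin N)) {u : ℕ} (hS : S.card ≤ u) {q : ℝ}
    (hq : 0 < q) : ∑ i, q ^ (symmDiff S {i}).card ≤ q ^ S.card * (u / q + N * q) := by
  have h1 : ∀ i, q ^ (symmDiff S {i}).card
      ≤ (if i ∈ S then q ^ S.card / q else 0) + q ^ S.card * q := by
    intro i
    by_cases hi : i ∈ S
    · have h2 : symmDiff S {i} = S.erase i := by
        ext k
        by_cases h : k = i <;> simp [Finset.mem_symmDiff, h, hi]
      have h3 : q ^ S.card = q ^ (S.erase i).card * q := by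
        rw [← pow_succ, Finset.card_erase_add_one hi]
      rw [if_pos hi, h2, h3, mul_div_cancel_right₀ _ hq.ne']
      have : 0 ≤ q ^ (S.erase i).card * q * q := by positivity
      linarith
    · have h2 : symmDiff S {i} = insert i S := by
        ext k
        by_cases h : k = i <;> simp [Finset.mem_symmDiff, h, hi]
      rw [if_neg hi, h2, Finset.card_insert_of_notMem hi, pow_succ, zero_add]
  refine (Finset.sum_le_sum fun i _ => h1 i).trans ?_
  rw [Finset.sum_add_distrib, ← Finset.sum_filter]
  simp only [Finset.filter_univ_mem, Finset.sum_const, Finset.card_univ, Fintype.card_fin,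
    nsmul_eq_mul]
  have h4 : (S.card : ℝ) * (q ^ S.card / q) ≤ u * (q ^ S.card / q) := by gcongr
  calc _ ≤ (u : ℝ) * (q ^ S.card / q) + N * (q ^ S.card * q) := by linarith
    _ = _ := by ring

lemma sum_pow_card_symmDiff_scope_le (S : Finset (Fin 4 × Fin N)) {u : ℕ}
    (hS : ∀ j, (group S j).card ≤ u) {q : ℝ} (hq : 0 < q) :
    ∑ a : Fin 4 → Fin N × Bool, q ^ (symmDiff S (scope a)).card
      ≤ q ^ S.card * (2 * (u / q + N * q)) ^ 4 := by
  have h1 : ∀ a : Fin 4 → Fin N × Bool, q ^ (symmDiff S (scope a)).card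
      = ∏ j, q ^ (symmDiff (group S j) {(a j).1}).card := fun a => by
    rw [card_eq_sum_group, Finset.prod_pow_eq_pow_sum]
    simp_rw [group_symmDiff_scope]
  have h2 := Finset.prod_univ_sum (fun _ : Fin 4 => (Finset.univ : Finset (Fin N × Bool)))
    fun j b => q ^ (symmDiff (group S j) {b.1}).card
  rw [Fintype.piFinset_univ] at h2
  simp_rw [h1]
  rw [← h2, card_eq_sum_group S, ← Finset.prod_pow_eq_pow_sum]
  have h3 : (2 * ((u : ℝ) / q + N * q)) ^ 4 = ∏ _j : Fin 4, (2 * ((u : ℝ) / q + N * q)) := by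
    simp
  rw [h3, ← Finset.prod_mul_distrib]
  refine Finset.prod_le_prod (fun j _ => Finset.sum_nonneg fun _ _ => by positivity) fun j _ => ?_
  rw [Fintype.sum_prod_type]
  simp only [Finset.sum_const, Finset.card_univ, Fintype.card_bool, nsmul_eq_mul]
  rw [← Finset.mul_sum]
  have := sum_pow_card_symmDiff_singleton_le (group S j) (hS j) hq
  push_cast
  linarith

lemma card_group_oddSet_le {m : ℕ} (ω : Fin m → Fin 4 → Fin N × Bool) (T : Finset (Fin m))
    (j : Fin 4) : (group (oddSet (fun C => scope (ω C)) T) j).card ≤ T.card := by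
  refine (Finset.card_le_card (t := T.image fun C => (ω C j).1) ?_).trans Finset.card_image_le
  intro i hi
  simp only [group, oddSet, Finset.mem_filter, Finset.mem_univ, true_and] at hi
  obtain ⟨C, hC⟩ := Finset.card_pos.mp hi.pos
  simp only [Finset.mem_filter, scope, Finset.mem_image, Finset.mem_univ, true_and,
    Prod.mk.injEq] at hC
  obtain ⟨hCT, j', rfl, h⟩ := hC
  exact Finset.mem_image.mpr ⟨C, hCT, h⟩

lemma sum_pow_card_oddSet_le {m u : ℕ} (hN : 0 < N) {q : ℝ} (hq : 0 < q)
    (T : Finset (Fin m)) (hT : T.card ≤ u) :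
    ∑ ω : Fin m → Fin 4 → Fin N × Bool, q ^ (oddSet (fun C => scope (ω C)) T).card
      ≤ Fintype.card (Fin m → Fin 4 → Fin N × Bool) * (((u / q + N * q) / N) ^ 4) ^ T.card := by
  induction T using Finset.induction_on with
  | empty => simp [oddSet_empty]
  | insert C T hC ih =>
    rw [Finset.card_insert_of_notMem hC] at hT
    have ih := ih (by omega)
    set ρ : ℝ := ((u / q + N * q) / N) ^ 4 with hρ
    have hρ0 : 0 ≤ ρ := by positivity
    have hNR : (0 : ℝ) < N := by exact_mod_cast hN
    have hcard : (Fintype.card (Fin 4 → Fin N × Bool) : ℝ) = (2 * N) ^ 4 := by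
      simp [mul_comm]
    have hpos : (0 : ℝ) < (2 * N) ^ 4 := by positivity
    have hodd : ∀ (ω : Fin m → Fin 4 → Fin N × Bool) (a : Fin 4 → Fin N × Bool),
        oddSet (fun D => scope (Function.update ω C a D)) (insert C T)
          = symmDiff (oddSet (fun D => scope (ω D)) T) (scope a) := by
      intro ω a
      rw [oddSet_insert _ hC, Function.update_self]
      congr 1
      ext v
      simp only [oddSet, Finset.mem_filter, Finset.mem_univ, true_and]
      have hfilter : (T.filter fun D => v ∈ scope (Function.update ω C a D))
          = T.filter fun D => v ∈ scope (ω D) := by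
        refine Finset.filter_congr fun D hD => ?_
        rw [Function.update_of_ne (ne_of_mem_of_not_mem hD hC)]
      rw [hfilter]
    have hmain := sum_sum_update C fun ω : Fin m → Fin 4 → Fin N × Bool =>
      q ^ (oddSet (fun D => scope (ω D)) (insert C T)).card
    simp_rw [hodd] at hmain
    rw [hcard] at hmain
    rw [← mul_le_mul_iff_right₀ hpos, ← hmain]
    calc _ ≤ ∑ ω : Fin m → Fin 4 → Fin N × Bool,
          q ^ (oddSet (fun D => scope (ω D)) T).card * (2 * (u / q + N * q)) ^ 4 :=
          Finset.sum_le_sum fun ω _ => sum_pow_card_symmDiff_scope_le _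
            (fun j => (card_group_oddSet_le ω T j).trans (by omega)) hq
      _ ≤ (Fintype.card (Fin m → Fin 4 → Fin N × Bool) * ρ ^ T.card)
          * (2 * (u / q + N * q)) ^ 4 := by
          rw [← Finset.sum_mul]
          gcongr
      _ = _ := by
          have hscale : (2 * ((u : ℝ) / q + N * q)) ^ 4 = (2 * N) ^ 4 * ρ := by
            rw [hρ]
            field_simp
          rw [Finset.card_insert_of_notMem hC, hscale]
          ring

end RandomInstance

section Existence

variable {N : ℕ}

lemma card_filter_oddSet_lt_le {m : ℕ} (T : Finset (Fin m)) (hT : T.Nonempty)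
    (hTN : T.card ≤ N) {q : ℝ} (hq : 0 < q) (hqT : q ^ 2 * N = T.card) :
    ((Finset.univ.filter fun ω : Fin m → Fin 4 → Fin N × Bool =>
        (oddSet (fun C => scope (ω C)) T).card < T.card).card : ℝ)
      ≤ Fintype.card (Fin m → Fin 4 → Fin N × Bool) * (16 * q ^ 3) ^ T.card := by
  have hN : 0 < N := (Finset.card_pos.mpr hT).trans_le hTN
  have hNR : (0 : ℝ) < N := by exact_mod_cast hN
  have hq1 : q ≤ 1 := by
    have h1 : (T.card : ℝ) ≤ N := by exact_mod_cast hTN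
    have h2 : q ^ 2 ≤ 1 := by
      by_contra hcon
      push Not at hcon
      nlinarith
    nlinarith
  have hsum := sum_pow_card_oddSet_le hN hq T le_rfl
  have hrate : (((T.card : ℝ) / q + N * q) / N) ^ 4 = 16 * q ^ 3 * q := by
    rw [← hqT]
    field_simp
    ring
  rw [hrate, mul_pow _ q, ← mul_assoc] at hsum
  rw [← mul_le_mul_iff_left₀ (pow_pos hq T.card)]
  refine le_trans ?_ hsum
  rw [← nsmul_eq_mul, ← Finset.sum_const]
  refine (Finset.sum_le_sum fun ω hω => ?_).trans
    (Finset.sum_le_sum_of_subset_of_nonneg (Finset.filter_subset _ _) fun _ _ _ => by positivity)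
  exact pow_le_pow_of_le_one hq.le hq1 (Finset.mem_filter.mp hω).2.le

lemma choose_mul_pow_le {K N u : ℕ} (hu : 0 < u) (huN : u * (192 * K) ^ 2 ≤ N) {q : ℝ}
    (hq : 0 < q) (hqu : q ^ 2 * N = u) (hK : 0 < K) :
    ((K * N).choose u : ℝ) * (16 * q ^ 3) ^ u ≤ (1 / 4) ^ u := by
  have huR : (0 : ℝ) < u := by exact_mod_cast hu
  have hKR : (0 : ℝ) < K := by exact_mod_cast hK
  have hsmall : q * (192 * K) ≤ 1 := by
    have h1 : (u : ℝ) * (192 * K) ^ 2 ≤ N := by exact_mod_cast huN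
    have hN : (0 : ℝ) < N := lt_of_lt_of_le (by positivity) h1
    have h2 : (q * (192 * K)) ^ 2 ≤ 1 := by
      rw [← hqu] at h1
      have : N * (q * (192 * K)) ^ 2 ≤ N * 1 := by linarith
      exact le_of_mul_le_mul_left this hN
    nlinarith [mul_pos hq hKR]
  have hfac : ((K * N : ℕ) : ℝ) ^ u / u.factorial ≤ (3 * (K / q ^ 2)) ^ u := by
    have h1 := Real.pow_div_factorial_le_exp (u : ℝ) huR.le u
    have h2 : Real.exp u ≤ 3 ^ u := by
      rw [← mul_one (u : ℝ), Real.exp_nat_mul]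
      exact pow_le_pow_left₀ (Real.exp_pos _).le Real.exp_one_lt_three.le u
    have h3 : ((K * N : ℕ) : ℝ) = K / q ^ 2 * u := by
      rw [← hqu]
      push_cast
      field_simp
    rw [h3, mul_pow, mul_pow, mul_div_assoc, mul_comm]
    exact mul_le_mul_of_nonneg_right (h1.trans h2) (by positivity)
  calc ((K * N).choose u : ℝ) * (16 * q ^ 3) ^ u
      ≤ (3 * (K / q ^ 2)) ^ u * (16 * q ^ 3) ^ u := by
        gcongr
        exact (Nat.choose_le_pow_div u (K * N)).trans hfac
    _ = (q * (192 * K) * (1 / 4)) ^ u := by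
        rw [← mul_pow]
        congr 1
        field_simp
        ring
    _ ≤ (1 / 4) ^ u := by
        refine pow_le_pow_left₀ (by positivity) ?_ u
        linarith

/-- Few instances violate the expansion property. -/
lemma card_filter_not_expanding_le {K t : ℕ} (hK : 0 < K) (ht : t * (192 * K) ^ 2 ≤ N) :
    ((Finset.univ.filter fun ω : Fin (K * N) → Fin 4 → Fin N × Bool =>
        ∃ T : Finset (Fin (K * N)), T.Nonempty ∧ T.card ≤ t ∧
          (oddSet (fun C => scope (ω C)) T).card < T.card).card : ℝ)
      ≤ Fintype.card (Fin (K * N) → Fin 4 → Fin N × Bool) * (1 / 3) := by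
  set M : ℝ := ((Fintype.card (Fin (K * N) → Fin 4 → Fin N × Bool) : ℕ) : ℝ) with hM
  set bad : Finset (Fin (K * N)) → Finset (Fin (K * N) → Fin 4 → Fin N × Bool) := fun T =>
    Finset.univ.filter fun ω => (oddSet (fun C => scope (ω C)) T).card < T.card with hbad
  have hsub : (Finset.univ.filter fun ω : Fin (K * N) → Fin 4 → Fin N × Bool =>
        ∃ T : Finset (Fin (K * N)), T.Nonempty ∧ T.card ≤ t ∧
          (oddSet (fun C => scope (ω C)) T).card < T.card)
      ⊆ (Finset.range t).biUnion fun u =>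
        (Finset.powersetCard (u + 1) Finset.univ).biUnion bad := by
    intro ω hω
    obtain ⟨T, hT, hTt, hlt⟩ := (Finset.mem_filter.mp hω).2
    have hpos := Finset.card_pos.mpr hT
    refine Finset.mem_biUnion.mpr ⟨T.card - 1, Finset.mem_range.mpr (by omega), ?_⟩
    refine Finset.mem_biUnion.mpr ⟨T, ?_, Finset.mem_filter.mpr ⟨Finset.mem_univ _, hlt⟩⟩
    exact Finset.mem_powersetCard.mpr ⟨Finset.subset_univ _, by omega⟩
  have hlevel : ∀ u ∈ Finset.range t,
      ∑ T ∈ Finset.powersetCard (u + 1) (Finset.univ : Finset (Fin (K * N))), ((bad T).card : ℝ)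
        ≤ M * (1 / 4) ^ (u + 1) := by
    intro u hu
    have hut : u + 1 ≤ t := by simpa using hu
    have huN : (u + 1) * (192 * K) ^ 2 ≤ N := (Nat.mul_le_mul_right _ hut).trans ht
    have huN' : u + 1 ≤ N := by
      refine le_trans ?_ huN
      exact Nat.le_mul_of_pos_right _ (by positivity)
    have hNR : (0 : ℝ) < N := by exact_mod_cast (by omega : 0 < N)
    set q : ℝ := Real.sqrt (((u + 1 : ℕ) : ℝ) / N) with hqdef
    have hq : 0 < q := Real.sqrt_pos.mpr (by positivity)
    have hqu : q ^ 2 * N = (u + 1 : ℕ) := by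
      rw [hqdef, Real.sq_sqrt (by positivity)]
      field_simp
    calc _ ≤ ∑ T ∈ Finset.powersetCard (u + 1) (Finset.univ : Finset (Fin (K * N))),
          M * (16 * q ^ 3) ^ (u + 1) := by
          refine Finset.sum_le_sum fun T hT => ?_
          have hcard := (Finset.mem_powersetCard.mp hT).2
          rw [← hcard]
          exact card_filter_oddSet_lt_le T (Finset.card_pos.mp (by omega)) (by omega) hq
            (by rw [hcard, hqu])
      _ = M * (((K * N).choose (u + 1) : ℝ) * (16 * q ^ 3) ^ (u + 1)) := by
          rw [Finset.sum_const, Finset.card_powersetCard, Finset.card_univ, Fintype.card_fin,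
            nsmul_eq_mul]
          ring
      _ ≤ M * (1 / 4) ^ (u + 1) := by
          refine mul_le_mul_of_nonneg_left ?_ (Nat.cast_nonneg _)
          exact choose_mul_pow_le (Nat.succ_pos u) huN hq hqu hK
  have hcount : ((Finset.univ.filter fun ω : Fin (K * N) → Fin 4 → Fin N × Bool =>
        ∃ T : Finset (Fin (K * N)), T.Nonempty ∧ T.card ≤ t ∧
          (oddSet (fun C => scope (ω C)) T).card < T.card).card : ℝ)
      ≤ ∑ u ∈ Finset.range t,
        ∑ T ∈ Finset.powersetCard (u + 1) (Finset.univ : Finset (Fin (K * N))),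
          ((bad T).card : ℝ) := by
    have h1 := (Finset.card_le_card hsub).trans (Finset.card_biUnion_le.trans
      (Finset.sum_le_sum fun u _ => Finset.card_biUnion_le))
    exact_mod_cast h1
  have hgeom : ∑ u ∈ Finset.range t, (1 / 4 : ℝ) ^ (u + 1) ≤ 1 / 3 := by
    have h1 : ∀ s : ℕ, ∑ u ∈ Finset.range s, (1 / 4 : ℝ) ^ (u + 1)
        = 1 / 3 - 1 / 3 * (1 / 4) ^ s := by
      intro s
      induction s with
      | zero => simp
      | succ s ih =>
        rw [Finset.sum_range_succ, ih]
        ring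
    rw [h1]
    have : (0 : ℝ) ≤ 1 / 3 * (1 / 4) ^ t := by positivity
    linarith
  refine hcount.trans ((Finset.sum_le_sum hlevel).trans ?_)
  rw [← Finset.mul_sum]
  exact mul_le_mul_of_nonneg_left hgeom (Nat.cast_nonneg _)

/-- The mean of a sign assignment to the literals of one group. -/
noncomputable def meanSgn {A : Type} [Fintype A] (b : A → Bool) : ℝ :=
  (∑ a, sgn (b a)) / Fintype.card A

/-- Few instances violate the discrepancy property. -/
lemma card_filter_discrepancy_le {m : ℕ} (hN : 0 < N) {η : ℝ} (hη : 0 < η) (hη' : η ≤ 8)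
    (hm : 640 * (N : ℝ) ≤ m * η ^ 2) :
    ((Finset.univ.filter fun ω : Fin m → Fin 4 → Fin N × Bool =>
        ∃ b : Fin 4 → Fin N × Bool → Bool,
          m * (absSumPoly (fun j => meanSgn (b j)) + η)
            ≤ ∑ C, |∑ j, sgn (b j (ω C j))|).card : ℝ)
      ≤ Fintype.card (Fin m → Fin 4 → Fin N × Bool) * (1 / 4) := by
  have : Nonempty (Fin N) := ⟨⟨0, hN⟩⟩
  set M : ℝ := ((Fintype.card (Fin m → Fin 4 → Fin N × Bool) : ℕ) : ℝ) with hM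
  set bad : (Fin 4 → Fin N × Bool → Bool) → Finset (Fin m → Fin 4 → Fin N × Bool) := fun b =>
    Finset.univ.filter fun ω => m * (absSumPoly (fun j => meanSgn (b j)) + η)
            ≤ ∑ C, |∑ j, sgn (b j (ω C j))| with hbad
  have hsub : (Finset.univ.filter fun ω : Fin m → Fin 4 → Fin N × Bool =>
        ∃ b : Fin 4 → Fin N × Bool → Bool,
          m * (absSumPoly (fun j => meanSgn (b j)) + η) ≤ ∑ C, |∑ j, sgn (b j (ω C j))|)
      ⊆ Finset.univ.biUnion bad := by
    intro ω hω
    obtain ⟨b, hb⟩ := (Finset.mem_filter.mp hω).2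
    exact Finset.mem_biUnion.mpr ⟨b, Finset.mem_univ _,
      Finset.mem_filter.mpr ⟨Finset.mem_univ _, hb⟩⟩
  have hone : ∀ b, ((bad b).card : ℝ) ≤ M * Real.exp (-(m * η ^ 2 / 64)) := by
    intro b
    set F : ℝ := absSumPoly fun j => meanSgn (b j) with hF
    have hP : (0 : ℝ) < (Fintype.card (Fin N × Bool) : ℝ) ^ 4 := by positivity
    have hmean : ∑ a : Fin 4 → Fin N × Bool, |∑ j, sgn (b j (a j))|
        = (Fintype.card (Fin N × Bool) : ℝ) ^ 4 * F := by
      simp_rw [abs_sum_sgn fun j => b j _]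
      exact sum_absSumPoly fun j a => sgn (b j a)
    have hcard : (Fintype.card (Fin 4 → Fin N × Bool) : ℝ)
        = (Fintype.card (Fin N × Bool) : ℝ) ^ 4 := by simp
    have hle : ∀ a : Fin 4 → Fin N × Bool, |∑ j, sgn (b j (a j))| ≤ 4 := fun a => by
      refine (Finset.abs_sum_le_sum_abs _ _).trans ?_
      have h1 : ∀ c : Bool, |sgn c| = 1 := fun c => by cases c <;> simp [sgn]
      simp [h1]
    have hF0 : 0 ≤ F := by
      have : 0 ≤ (Fintype.card (Fin N × Bool) : ℝ) ^ 4 * F := by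
        rw [← hmean]
        exact Finset.sum_nonneg fun _ _ => abs_nonneg _
      exact nonneg_of_mul_nonneg_right this hP
    have hF4 : F ≤ 4 := by
      have : (Fintype.card (Fin N × Bool) : ℝ) ^ 4 * F
          ≤ (Fintype.card (Fin N × Bool) : ℝ) ^ 4 * 4 := by
        rw [← hmean, ← hcard, ← nsmul_eq_mul, ← Finset.card_univ]
        exact Finset.sum_le_card_nsmul _ _ _ fun a _ => hle a
      exact le_of_mul_le_mul_left this hP
    have htail := card_filter_le_sum_le m
      (fun a : Fin 4 → Fin N × Bool => |∑ j, sgn (b j (a j))| - F)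
      (fun a => by
        rw [abs_le]
        constructor <;> linarith [hle a, abs_nonneg (∑ j, sgn (b j (a j)))])
      (by
        rw [Finset.sum_sub_distrib, hmean, Finset.sum_const, Finset.card_univ, nsmul_eq_mul,
          hcard, sub_self]) hη hη'
    refine le_trans (le_of_eq ?_) htail
    simp only [hbad]
    congr 2
    refine Finset.filter_congr fun ω _ => ?_
    rw [Finset.sum_sub_distrib, Finset.sum_const, Finset.card_univ, Fintype.card_fin,
      nsmul_eq_mul]
    constructor <;> intro h <;> linarith
  have hcount : (Fintype.card (Fin 4 → Fin N × Bool → Bool) : ℝ) ≤ Real.exp (8 * N) := by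
    have h1 : (Fintype.card (Fin 4 → Fin N × Bool → Bool) : ℝ) = 2 ^ (8 * N) := by
      simp only [Fintype.card_fun, Fintype.card_prod, Fintype.card_fin, Fintype.card_bool]
      push_cast
      rw [← pow_mul]
      congr 1
      ring
    rw [h1]
    have h2 : Real.exp (8 * N) = Real.exp 1 ^ (8 * N) := by
      rw [← Real.exp_nat_mul]
      push_cast
      ring_nf
    rw [h2]
    exact pow_le_pow_left₀ (by norm_num) (by linarith [Real.exp_one_gt_d9]) _
  have hexp : Real.exp (8 * N) * Real.exp (-(m * η ^ 2 / 64)) ≤ 1 / 4 := by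
    rw [← Real.exp_add]
    have hN1 : (1 : ℝ) ≤ N := by exact_mod_cast hN
    have h1 : Real.exp (8 * N + -(m * η ^ 2 / 64)) ≤ Real.exp (-2) := by
      rw [Real.exp_le_exp]
      linarith
    have h2 : Real.exp (-2) ≤ 1 / 4 := by
      have h3 : (4 : ℝ) ≤ Real.exp 2 := by
        have h4 : Real.exp 2 = Real.exp 1 * Real.exp 1 := by
          rw [← Real.exp_add]
          norm_num
        rw [h4]
        nlinarith [Real.exp_one_gt_d9]
      rw [Real.exp_neg, ← one_div]
      exact one_div_le_one_div_of_le (by norm_num) h3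
    exact h1.trans h2
  calc _ ≤ ∑ b, ((bad b).card : ℝ) := by
        exact_mod_cast (Finset.card_le_card hsub).trans Finset.card_biUnion_le
    _ ≤ ∑ _b : Fin 4 → Fin N × Bool → Bool, M * Real.exp (-(m * η ^ 2 / 64)) :=
        Finset.sum_le_sum fun b _ => hone b
    _ = M * (Fintype.card (Fin 4 → Fin N × Bool → Bool) * Real.exp (-(m * η ^ 2 / 64))) := by
        rw [Finset.sum_const, Finset.card_univ, nsmul_eq_mul]
        ring
    _ ≤ M * (1 / 4) := by
        refine mul_le_mul_of_nonneg_left (le_trans ?_ hexp) (Nat.cast_nonneg _)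
        exact mul_le_mul_of_nonneg_right hcount (Real.exp_pos _).le

/-- There is an instance with both the expansion and the discrepancy property. -/
lemma exists_expanding_instance {K t : ℕ} (hK : 0 < K) (hN : 0 < N)
    (ht : t * (192 * K) ^ 2 ≤ N) {η : ℝ} (hη : 0 < η) (hη' : η ≤ 8) (hKη : 640 ≤ K * η ^ 2) :
    ∃ ω : Fin (K * N) → Fin 4 → Fin N × Bool,
      (∀ T : Finset (Fin (K * N)), T.Nonempty → T.card ≤ t →
        T.card ≤ (oddSet (fun C => scope (ω C)) T).card) ∧
      ∀ b : Fin 4 → Fin N × Bool → Bool,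
        ∑ C, |∑ j, sgn (b j (ω C j))|
          ≤ (K * N : ℕ) * (absSumPoly (fun j => meanSgn (b j)) + η) := by
  by_contra hcon
  push Not at hcon
  have : Nonempty (Fin N) := ⟨⟨0, hN⟩⟩
  have h1 := card_filter_not_expanding_le hK ht
  have h2 := card_filter_discrepancy_le (m := K * N) hN hη hη' (by
    push_cast
    have : (0 : ℝ) ≤ N := Nat.cast_nonneg _
    nlinarith)
  have hcover : (Finset.univ : Finset (Fin (K * N) → Fin 4 → Fin N × Bool))
      ⊆ (Finset.univ.filter fun ω : Fin (K * N) → Fin 4 → Fin N × Bool =>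
          ∃ T : Finset (Fin (K * N)), T.Nonempty ∧ T.card ≤ t ∧
            (oddSet (fun C => scope (ω C)) T).card < T.card) ∪
        (Finset.univ.filter fun ω : Fin (K * N) → Fin 4 → Fin N × Bool =>
          ∃ b : Fin 4 → Fin N × Bool → Bool,
            (K * N : ℕ) * (absSumPoly (fun j => meanSgn (b j)) + η)
              ≤ ∑ C, |∑ j, sgn (b j (ω C j))|) := by
    intro ω _
    by_cases h : ∃ T : Finset (Fin (K * N)), T.Nonempty ∧ T.card ≤ t ∧
        (oddSet (fun C => scope (ω C)) T).card < T.card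
    · exact Finset.mem_union_left _ (Finset.mem_filter.mpr ⟨Finset.mem_univ _, h⟩)
    · push Not at h
      obtain ⟨b, hb⟩ := hcon ω h
      exact Finset.mem_union_right _ (Finset.mem_filter.mpr ⟨Finset.mem_univ _, b, hb.le⟩)
  have h3 := (Finset.card_le_card hcover).trans (Finset.card_union_le _ _)
  rw [Finset.card_univ] at h3
  have h4 : (0 : ℝ) < Fintype.card (Fin (K * N) → Fin 4 → Fin N × Bool) := by
    exact_mod_cast Fintype.card_pos
  have h5 : (Fintype.card (Fin (K * N) → Fin 4 → Fin N × Bool) : ℝ)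
      ≤ Fintype.card (Fin (K * N) → Fin 4 → Fin N × Bool) * (1 / 3)
        + Fintype.card (Fin (K * N) → Fin 4 → Fin N × Bool) * (1 / 4) := by
    refine le_trans ?_ (add_le_add h1 h2)
    exact_mod_cast h3
  linarith

end Existence

section XorPseudoexpectation

variable {V ι : Type} [Fintype V] [DecidableEq V] [Fintype ι] [DecidableEq ι]
  {E : ι → Finset V} {β : ι → ℝ} {t n d : ℕ}

/-- The pseudoexpectation obtained from `xorDensity` by substituting functions of degree at
most five of the base variables for the variables of a polynomial. -/
noncomputable def xorPE (φ : (V → Bool) → Fin n → Bool)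
    (hφ : ∀ v, (fun x => sgn (φ x v)) ∈ lowDeg V 5) (hβ : ∀ C, β C * β C = 1)
    (hE : ∀ C, (E C).card ≤ 4)
    (hexp : ∀ T : Finset ι, T.Nonempty → T.card ≤ t + 1 → T.card ≤ (oddSet E T).card)
    (hd : 25 * d < t) : PEpm n d where
  pE :=
    { toFun := fun p => (∑ x, MvPolynomial.eval (fun v => sgn (φ x v)) p * xorDensity E β t x)
        / (2 : ℝ) ^ Fintype.card V
      map_add' := fun p q => by
        simp only [map_add, add_mul, Finset.sum_add_distrib, add_div]
      map_smul' := fun r p => by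
        simp only [MvPolynomial.smul_eval, mul_assoc, ← Finset.mul_sum, mul_div_assoc,
          RingHom.id_apply, smul_eq_mul] }
  normalized := by
    simp [sum_xorDensity hexp]
  multilin := fun p q h => by
    simp only [LinearMap.coe_mk, AddHom.coe_mk]
    congr 1
    exact Finset.sum_congr rfl fun x _ => by rw [h (φ x)]
  psd := fun p hp => by
    simp only [LinearMap.coe_mk, AddHom.coe_mk, map_pow]
    exact div_nonneg (sum_sq_mul_xorDensity_nonneg hβ hE hexp (h := 5 * p.totalDegree)
      (by omega) (eval_mem_lowDeg hφ p)) (by positivity)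

lemma xorPE_satEq (φ : (V → Bool) → Fin n → Bool)
    (hφ : ∀ v, (fun x => sgn (φ x v)) ∈ lowDeg V 5) (hβ : ∀ C, β C * β C = 1)
    (hE : ∀ C, (E C).card ≤ 4)
    (hexp : ∀ T : Finset ι, T.Nonempty → T.card ≤ t + 1 → T.card ≤ (oddSet E T).card)
    (hd : 25 * d < t) {a : ℕ} {Q : MvPolynomial (Fin n) ℝ} {b : ℝ} {g : ι → (V → Bool) → ℝ}
    (hg : ∀ C, g C ∈ lowDeg V a) (hQ : Q.totalDegree ≤ 2) (ha : a + 10 < t)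
    (heq : ∀ x, MvPolynomial.eval (fun v => sgn (φ x v)) Q
      = b + ∑ C, g C x * (1 - β C * chi (E C) x)) :
    (xorPE φ hφ hβ hE hexp hd).satEq Q b := by
  have hM : (2 : ℝ) ^ Fintype.card V ≠ 0 := by positivity
  have hgen : ∀ (r : ℝ) (f : ι → (V → Bool) → ℝ), (∀ C, f C ∈ lowDeg V (a + 10)) →
      (∑ x, (r + ∑ C, f C x * (1 - β C * chi (E C) x)) * xorDensity E β t x)
        / (2 : ℝ) ^ Fintype.card V = r := by
    intro r f hf
    have h1 : ∑ x, (∑ C, f C x * (1 - β C * chi (E C) x)) * xorDensity E β t x = 0 := by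
      simp_rw [Finset.sum_mul]
      rw [Finset.sum_comm]
      exact Finset.sum_eq_zero fun C _ => sum_mul_one_sub_mul_xorDensity hβ hexp ha (hf C) C
    simp_rw [add_mul]
    rw [Finset.sum_add_distrib, h1, add_zero, ← Finset.mul_sum, sum_xorDensity hexp,
      mul_div_assoc, div_self hM, mul_one]
  have hQlow : (fun x => MvPolynomial.eval (fun v => sgn (φ x v)) Q) ∈ lowDeg V 10 :=
    lowDeg_mono (by omega) (eval_mem_lowDeg hφ Q)
  constructor
  · have h1 := hgen b g fun C => lowDeg_mono (by omega) (hg C)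
    simp_rw [← heq] at h1
    exact h1
  · have h1 := hgen (b ^ 2)
      (fun C => g C * ((fun x => MvPolynomial.eval (fun v => sgn (φ x v)) Q) + fun _ => b))
      fun C => mul_mem_lowDeg (hg C) (Submodule.add_mem _ hQlow (const_mem_lowDeg b 10))
    rw [← h1]
    change (∑ x : V → Bool, MvPolynomial.eval (fun v => sgn (φ x v)) (Q ^ 2)
      * xorDensity E β t x) / (2 : ℝ) ^ Fintype.card V = _
    congr 1
    refine Finset.sum_congr rfl fun x _ => ?_
    congr 1
    simp only [Pi.mul_apply, Pi.add_apply]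
    have h2 : ∑ C, g C x * (MvPolynomial.eval (fun v => sgn (φ x v)) Q + b)
          * (1 - β C * chi (E C) x)
        = (∑ C, g C x * (1 - β C * chi (E C) x))
          * (MvPolynomial.eval (fun v => sgn (φ x v)) Q + b) := by
      rw [Finset.sum_mul]
      exact Finset.sum_congr rfl fun C _ => by ring
    rw [h2, map_pow, heq x]
    ring

end XorPseudoexpectation

section Graph

variable {N L m D : ℕ}

/-- The vertices of the instance: `L` copies of every literal, a vertex and its antipode for
every constraint, and `D` pairs of padding vertices. -/
abbrev Vtx (N L m D : ℕ) : Type :=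
  ((Fin 4 × Fin N × Bool) × Fin L) ⊕ (Fin m × Bool) ⊕ (Fin D × Bool)

/-- The edges joining a constraint vertex to all copies of its four literals. -/
def constraintEdges (D : ℕ) (L : ℕ) (ω : Fin m → Fin 4 → Fin N × Bool) :
    Finset (Vtx N L m D × Vtx N L m D) :=
  Finset.univ.map ⟨fun p : Fin m × Fin 4 × Fin L =>
    (Sum.inr (Sum.inl (p.1, true)), Sum.inl ((p.2.1, ω p.1 p.2.1), p.2.2)), by
      rintro ⟨C, j, l⟩ ⟨C', j', l'⟩ h
      simp only [Prod.mk.injEq, Sum.inr.injEq, Sum.inl.injEq] at h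
      simp [h.1.1, h.2.1.1, h.2.2]⟩

/-- The pairs of distinct padding vertices of positive sign. -/
def paddingPairs (N L m D : ℕ) : Finset (Vtx N L m D × Vtx N L m D) :=
  (Finset.univ.map ⟨fun k : Fin D => (Sum.inr (Sum.inr (k, true)) : Vtx N L m D), by
    intro k k' h
    simpa using h⟩).offDiag

lemma card_constraintEdges (ω : Fin m → Fin 4 → Fin N × Bool) :
    (constraintEdges D L ω).card = 4 * L * m := by
  simp only [constraintEdges, Finset.card_map, Finset.card_univ, Fintype.card_prod,
    Fintype.card_fin]
  ring

lemma card_paddingPairs : (paddingPairs N L m D).card = D * D - D := by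
  simp [paddingPairs, Finset.offDiag_card]

lemma disjoint_constraintEdges (ω : Fin m → Fin 4 → Fin N × Bool)
    {P : Finset (Vtx N L m D × Vtx N L m D)} (hP : P ⊆ paddingPairs N L m D) :
    Disjoint (constraintEdges D L ω) P := by
  refine Finset.disjoint_left.mpr fun e he heP => ?_
  have h1 := hP heP
  simp only [paddingPairs, Finset.mem_offDiag, Finset.mem_map, Finset.mem_univ, true_and] at h1
  simp only [constraintEdges, Finset.mem_map, Finset.mem_univ, true_and] at he
  obtain ⟨p, rfl⟩ := he
  obtain ⟨⟨k, hk⟩, _⟩ := h1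
  have h2 : (Sum.inr (Sum.inr (k, true)) : Vtx N L m D) = Sum.inr (Sum.inl (p.1, true)) := hk
  simp at h2

/-- The edges of the instance. -/
def instanceEdges (ω : Fin m → Fin 4 → Fin N × Bool)
    {P : Finset (Vtx N L m D × Vtx N L m D)} (hP : P ⊆ paddingPairs N L m D) :
    Finset (Vtx N L m D × Vtx N L m D) :=
  (constraintEdges D L ω).disjUnion P (disjoint_constraintEdges ω hP)

lemma sum_constraintEdges (ω : Fin m → Fin 4 → Fin N × Bool)
    (f : Vtx N L m D × Vtx N L m D → ℝ) :
    ∑ e ∈ constraintEdges D L ω, f e = ∑ C, ∑ j, ∑ l,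
      f (Sum.inr (Sum.inl (C, true)), Sum.inl ((j, ω C j), l)) := by
  simp only [constraintEdges, Finset.sum_map, Fintype.sum_prod_type]
  rfl

/-- The opposite of the majority of four signs with negative product, and the first sign in the
other cases. -/
def antiMajority (a : Fin 4 → Bool) : Bool :=
  if (a 0 ^^ a 1 ^^ a 2 ^^ a 3) then !((a 0 && a 1) || (a 2 && a 3)) else a 0

lemma sgn_antiMajority (a : Fin 4 → Bool) :
    sgn (antiMajority a) = -(1 / 4) * (∑ j, sgn (a j)) * (1 - ∏ j, sgn (a j))
      + 1 / 2 * sgn (a 0) * (1 + ∏ j, sgn (a j)) := by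
  rw [antiMajority, Fin.sum_univ_four, Fin.prod_univ_four]
  cases a 0 <;> cases a 1 <;> cases a 2 <;> cases a 3 <;> norm_num [sgn]

lemma sum_sq_antiMajority_sub (a : Fin 4 → Bool) :
    ∑ j, (sgn (antiMajority a) - sgn (a j)) ^ 2
      = 12 - (sgn (a 0) * ∑ j, sgn (a j) + 2) * (1 + ∏ j, sgn (a j)) := by
  rw [antiMajority, Fin.sum_univ_four, Fin.sum_univ_four, Fin.prod_univ_four]
  cases a 0 <;> cases a 1 <;> cases a 2 <;> cases a 3 <;> norm_num [sgn]

lemma sgn_beq (a b : Bool) : sgn (a == b) = sgn a * sgn b := by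
  cases a <;> cases b <;> simp [sgn]

/-- The value of a literal under an assignment to the base variables. -/
def litVal (x : Fin 4 × Fin N → Bool) (p : Fin 4 × Fin N × Bool) : Bool :=
  p.2.2 == x (p.1, p.2.1)

/-- The values of the vertices that an assignment to the base variables induces. -/
def vtxVal (ω : Fin m → Fin 4 → Fin N × Bool) (x : Fin 4 × Fin N → Bool) : Vtx N L m D → Bool
  | Sum.inl p => litVal x p.1
  | Sum.inr (Sum.inl q) => q.2 == antiMajority fun j => litVal x (j, ω q.1 j)
  | Sum.inr (Sum.inr r) => r.2

/-- The right-hand side of the parity constraint `a`. -/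
noncomputable def paritySign (a : Fin 4 → Fin N × Bool) : ℝ := -∏ j, sgn (a j).2

lemma paritySign_mul_self (a : Fin 4 → Fin N × Bool) : paritySign a * paritySign a = 1 := by
  simp [paritySign, ← Finset.prod_mul_distrib, sgn_mul_self]

lemma paritySign_mul_chi (a : Fin 4 → Fin N × Bool) (x : Fin 4 × Fin N → Bool) :
    paritySign a * chi (scope a) x = -∏ j, sgn (litVal x (j, a j)) := by
  have h1 : chi (scope a) x = ∏ j, sgn (x (j, (a j).1)) := by
    rw [chi, scope, Finset.prod_image]
    intro j _ j' _ h
    exact (Prod.mk.inj h).1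
  simp only [h1, paritySign, litVal, sgn_beq, Finset.prod_mul_distrib, neg_mul]

lemma litVal_mem_lowDeg (p : Fin 4 × Fin N × Bool) :
    (fun x => sgn (litVal x p)) ∈ lowDeg (Fin 4 × Fin N) 1 := by
  have h1 : (fun x : Fin 4 × Fin N → Bool => sgn (litVal x p))
      = sgn p.2.2 • fun x => sgn (x (p.1, p.2.1)) := by
    ext x
    simp [litVal, sgn_beq]
  rw [h1]
  exact Submodule.smul_mem _ _ (coord_mem_lowDeg _)

lemma sum_litVal_mem_lowDeg (a : Fin 4 → Fin N × Bool) :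
    (fun x => ∑ j, sgn (litVal x (j, a j))) ∈ lowDeg (Fin 4 × Fin N) 1 := by
  have h1 : (fun x => ∑ j, sgn (litVal x (j, a j))) = ∑ j, fun x => sgn (litVal x (j, a j)) := by
    ext x
    simp
  rw [h1]
  exact Submodule.sum_mem _ fun j _ => litVal_mem_lowDeg _

lemma prod_litVal_mem_lowDeg (a : Fin 4 → Fin N × Bool) :
    (fun x => ∏ j, sgn (litVal x (j, a j))) ∈ lowDeg (Fin 4 × Fin N) 4 := by
  have h1 : (fun x => ∏ j, sgn (litVal x (j, a j))) = ∏ j, fun x => sgn (litVal x (j, a j)) := by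
    ext x
    simp [Finset.prod_apply]
  rw [h1]
  simpa using prod_mem_lowDeg Finset.univ (a := fun _ => 1) fun j _ => litVal_mem_lowDeg (j, a j)

lemma vtxVal_mem_lowDeg (ω : Fin m → Fin 4 → Fin N × Bool) (v : Vtx N L m D) :
    (fun x => sgn (vtxVal ω x v)) ∈ lowDeg (Fin 4 × Fin N) 5 := by
  rcases v with p | q | r
  · exact lowDeg_mono (by norm_num) (litVal_mem_lowDeg p.1)
  · set e1 : (Fin 4 × Fin N → Bool) → ℝ := fun x => ∑ j, sgn (litVal x (j, ω q.1 j)) with he1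
    set e4 : (Fin 4 × Fin N → Bool) → ℝ := fun x => ∏ j, sgn (litVal x (j, ω q.1 j)) with he4
    have h1 : (fun x => sgn (vtxVal ω x (Sum.inr (Sum.inl q) : Vtx N L m D)))
        = sgn q.2 • ((-(1 / 4 : ℝ)) • (e1 * ((fun _ => 1) - e4))
          + (1 / 2 : ℝ) • ((fun x => sgn (litVal x (0, ω q.1 0))) * ((fun _ => 1) + e4))) := by
      ext x
      simp only [vtxVal, sgn_beq, sgn_antiMajority, Pi.smul_apply, Pi.add_apply, Pi.mul_apply,
        Pi.sub_apply, smul_eq_mul, he1, he4]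
      ring
    rw [h1]
    have he4m : e4 ∈ lowDeg (Fin 4 × Fin N) 4 := prod_litVal_mem_lowDeg (ω q.1)
    refine Submodule.smul_mem _ _ (Submodule.add_mem _ (Submodule.smul_mem _ _ ?_)
      (Submodule.smul_mem _ _ ?_))
    · exact mul_mem_lowDeg (a := 1) (b := 4) (sum_litVal_mem_lowDeg (ω q.1))
        (Submodule.sub_mem _ (const_mem_lowDeg 1 4) he4m)
    · exact mul_mem_lowDeg (a := 1) (b := 4) (litVal_mem_lowDeg (0, ω q.1 0))
        (Submodule.add_mem _ (const_mem_lowDeg 1 4) he4m)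
  · exact const_mem_lowDeg (sgn r.2) 5

lemma sum_vtxVal (ω : Fin m → Fin 4 → Fin N × Bool) (x : Fin 4 × Fin N → Bool) :
    ∑ v : Vtx N L m D, sgn (vtxVal ω x v) = 0 := by
  have h1 : ∀ a : ℝ, ∑ b : Bool, sgn b * a = 0 := fun a => by
    rw [← Finset.sum_mul, sum_sgn, zero_mul]
  have h2 : ∑ p : (Fin 4 × Fin N × Bool) × Fin L, sgn (litVal x p.1) = 0 := by
    rw [Fintype.sum_prod_type_right]
    refine Finset.sum_eq_zero fun l _ => ?_
    simp only [Fintype.sum_prod_type, litVal, sgn_beq, h1, Finset.sum_const_zero]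
  rw [Fintype.sum_sum_type, Fintype.sum_sum_type]
  simp only [vtxVal, h2]
  simp only [Fintype.sum_prod_type, sgn_beq, h1, sum_sgn, Finset.sum_const_zero, add_zero]

lemma sum_sq_vtxVal_sub (ω : Fin m → Fin 4 → Fin N × Bool)
    {P : Finset (Vtx N L m D × Vtx N L m D)} (hP : P ⊆ paddingPairs N L m D)
    (x : Fin 4 × Fin N → Bool) :
    ∑ e ∈ instanceEdges ω hP, (sgn (vtxVal ω x e.1) - sgn (vtxVal ω x e.2)) ^ 2
      = 12 * L * m + ∑ C, -(L * (sgn (litVal x (0, ω C 0)) * ∑ j, sgn (litVal x (j, ω C j)) + 2))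
        * (1 - paritySign (ω C) * chi (scope (ω C)) x) := by
  rw [instanceEdges, Finset.sum_disjUnion]
  have hpad : ∑ e ∈ P, (sgn (vtxVal ω x e.1) - sgn (vtxVal ω x e.2)) ^ 2 = 0 := by
    refine Finset.sum_eq_zero fun e he => ?_
    have h1 := hP he
    simp only [paddingPairs, Finset.mem_offDiag, Finset.mem_map, Finset.mem_univ, true_and] at h1
    obtain ⟨⟨k, hk⟩, ⟨k', hk'⟩, _⟩ := h1
    rw [← hk, ← hk']
    change (sgn true - sgn true) ^ 2 = 0
    simp
  rw [hpad, add_zero, sum_constraintEdges]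
  have hC : ∀ C, ∑ j, ∑ _l : Fin L, (sgn (vtxVal ω x
        (Sum.inr (Sum.inl (C, true)) : Vtx N L m D))
        - sgn (vtxVal ω x (Sum.inl ((j, ω C j), _l) : Vtx N L m D))) ^ 2
      = 12 * L + -(L * (sgn (litVal x (0, ω C 0)) * ∑ j, sgn (litVal x (j, ω C j)) + 2))
        * (1 - paritySign (ω C) * chi (scope (ω C)) x) := by
    intro C
    have h1 := sum_sq_antiMajority_sub fun j => litVal x (j, ω C j)
    have h2 : ∀ b : Bool, (true == b) = b := fun b => by cases b <;> rfl
    simp only [vtxVal, h2, Finset.sum_const, Finset.card_univ, Fintype.card_fin, nsmul_eq_mul]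
    rw [← Finset.mul_sum, h1, paritySign_mul_chi]
    ring
  simp_rw [hC]
  rw [Finset.sum_add_distrib, Finset.sum_const, Finset.card_univ, Fintype.card_fin, nsmul_eq_mul]
  ring

/-- Completeness: an expanding instance has a pseudoexpectation that satisfies the bisection
constraint and cuts three quarters of the constraint edges and no padding edge. -/
lemma exists_pseudoexpectation {n d t : ℕ} (e : Vtx N L m D ≃ Fin n)
    (ω : Fin m → Fin 4 → Fin N × Bool)
    (hexp : ∀ T : Finset (Fin m), T.Nonempty → T.card ≤ t + 1 →
      T.card ≤ (oddSet (fun C => scope (ω C)) T).card)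
    (hd : 25 * d < t) (ht : 20 < t) {P : Finset (Vtx N L m D × Vtx N L m D)}
    (hP : P ⊆ paddingPairs N L m D) (r : ℝ) :
    ∃ E : PEpm n d,
      (∀ v : Fin n, E.satEq (MvPolynomial.X v ^ 2) 1) ∧
      E.satEq (∑ v : Fin n, MvPolynomial.X v) 0 ∧
      E.satEq (MvPolynomial.C r *
        ∑ p ∈ (instanceEdges ω hP).map (e.prodCongr e).toEmbedding,
          (MvPolynomial.X p.1 - MvPolynomial.X p.2) ^ 2) (r * (12 * L * m)) := by
  set φ : (Fin 4 × Fin N → Bool) → Fin n → Bool := fun x v => vtxVal ω x (e.symm v) with hφdef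
  have hφ : ∀ v, (fun x => sgn (φ x v)) ∈ lowDeg (Fin 4 × Fin N) 5 := fun v =>
    vtxVal_mem_lowDeg ω _
  have hβ : ∀ C, paritySign (ω C) * paritySign (ω C) = 1 := fun C => paritySign_mul_self _
  have hE : ∀ C, (scope (ω C)).card ≤ 4 := fun C => card_scope_le _
  refine ⟨xorPE φ hφ hβ hE hexp hd, fun v => ?_, ?_, ?_⟩
  · refine xorPE_satEq φ hφ hβ hE hexp hd (a := 0) (g := fun _ => 0)
      (fun _ => Submodule.zero_mem _) ?_ (by omega) fun x => ?_
    · exact (MvPolynomial.totalDegree_pow _ _).trans (by simp)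
    · simp [pow_two, sgn_mul_self]
  · refine xorPE_satEq φ hφ hβ hE hexp hd (a := 0) (g := fun _ => 0)
      (fun _ => Submodule.zero_mem _) ?_ (by omega) fun x => ?_
    · refine MvPolynomial.totalDegree_finsetSum_le fun v _ => ?_
      simp
    · have h1 : ∑ v : Fin n, sgn (φ x v) = ∑ v, sgn (vtxVal ω x v) :=
        Equiv.sum_comp e.symm fun v => sgn (vtxVal ω x v)
      simp only [map_sum, MvPolynomial.eval_X, h1, sum_vtxVal]
      simp
  · refine xorPE_satEq φ hφ hβ hE hexp hd (a := 2)
      (g := fun C => (-(r * L)) • ((fun x => sgn (litVal x (0, ω C 0)))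
        * (fun x => ∑ j, sgn (litVal x (j, ω C j))) + fun _ => 2)) (fun C => ?_) ?_ (by omega)
      fun x => ?_
    · refine Submodule.smul_mem _ _ (Submodule.add_mem _ ?_ (const_mem_lowDeg 2 2))
      exact mul_mem_lowDeg (a := 1) (b := 1) (litVal_mem_lowDeg _) (sum_litVal_mem_lowDeg _)
    · refine (MvPolynomial.totalDegree_mul _ _).trans ?_
      rw [MvPolynomial.totalDegree_C, zero_add]
      refine MvPolynomial.totalDegree_finsetSum_le fun p _ => ?_
      refine (MvPolynomial.totalDegree_pow _ _).trans ?_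
      have := MvPolynomial.totalDegree_sub (MvPolynomial.X p.1 : MvPolynomial (Fin n) ℝ)
        (MvPolynomial.X p.2)
      simp only [MvPolynomial.totalDegree_X, max_self] at this
      omega
    · have h1 := sum_sq_vtxVal_sub ω hP x
      simp only [map_mul, MvPolynomial.eval_C, map_sum, map_pow, map_sub, MvPolynomial.eval_X,
        Finset.sum_map, Equiv.coe_toEmbedding, Equiv.prodCongr_apply, Prod.map_fst,
        Prod.map_snd, hφdef, Equiv.symm_apply_apply]
      rw [h1, mul_add, Finset.mul_sum]
      congr 1
      refine Finset.sum_congr rfl fun C _ => ?_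
      simp only [Pi.smul_apply, Pi.add_apply, Pi.mul_apply, smul_eq_mul]
      ring

end Graph

section Soundness

variable {N L m D : ℕ}

lemma abs_sgn (b : Bool) : |sgn b| = 1 := by
  cases b <;> simp [sgn]

lemma pow_three_mul_abs_sum_le (g : Fin 4 → Fin L → ℝ) :
    (L : ℝ) ^ 3 * |∑ j, ∑ l, g j l| ≤ ∑ a : Fin 4 → Fin L, |∑ j, g j (a j)| := by
  have h0 := sum_prod_apply ![g 0, fun _ => 1, fun _ => 1, fun _ => 1]
  have h1 := sum_prod_apply ![fun _ => 1, g 1, fun _ => 1, fun _ => 1]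
  have h2 := sum_prod_apply ![fun _ => 1, fun _ => 1, g 2, fun _ => 1]
  have h3 := sum_prod_apply ![fun _ => 1, fun _ => 1, fun _ => 1, g 3]
  simp only [Matrix.cons_val, mul_one, one_mul, Finset.sum_const, Finset.card_univ,
    nsmul_eq_mul, Fintype.card_fin] at h0 h1 h2 h3
  have h4 : ∑ a : Fin 4 → Fin L, ∑ j, g j (a j) = (L : ℝ) ^ 3 * ∑ j, ∑ l, g j l := by
    simp only [Fin.sum_univ_four, Finset.sum_add_distrib, h0, h1, h2, h3]
    ring
  calc (L : ℝ) ^ 3 * |∑ j, ∑ l, g j l| = |∑ a : Fin 4 → Fin L, ∑ j, g j (a j)| := by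
        rw [h4, abs_mul, abs_of_nonneg (by positivity : (0 : ℝ) ≤ (L : ℝ) ^ 3)]
    _ ≤ _ := Finset.abs_sum_le_sum_abs _ _

lemma sum_abs_copies_le {ω : Fin m → Fin 4 → Fin N × Bool} {η : ℝ} (hL : 0 < L)
    (hω : ∀ b : Fin 4 → Fin N × Bool → Bool, ∑ C, |∑ j, sgn (b j (ω C j))|
      ≤ m * (absSumPoly (fun j => meanSgn (b j)) + η))
    (a : Fin 4 → Fin N × Bool → Fin L → Bool) :
    ∑ C, |∑ j, ∑ l, sgn (a j (ω C j) l)|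
      ≤ m * L * (absSumPoly (fun j => (∑ l, meanSgn fun p => a j p l) / L) + η) := by
  have : Nonempty (Fin L) := ⟨⟨0, hL⟩⟩
  have hL' : (0 : ℝ) < (L : ℝ) ^ 3 := by positivity
  refine le_of_mul_le_mul_left ?_ hL'
  have h1 := sum_absSumPoly fun j (l : Fin L) => meanSgn fun p => a j p l
  rw [Fintype.card_fin] at h1
  calc (L : ℝ) ^ 3 * ∑ C, |∑ j, ∑ l, sgn (a j (ω C j) l)|
      ≤ ∑ C, ∑ k : Fin 4 → Fin L, |∑ j, sgn (a j (ω C j) (k j))| := by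
        rw [Finset.mul_sum]
        exact Finset.sum_le_sum fun C _ =>
          pow_three_mul_abs_sum_le fun j l => sgn (a j (ω C j) l)
    _ = ∑ k : Fin 4 → Fin L, ∑ C, |∑ j, sgn (a j (ω C j) (k j))| := Finset.sum_comm
    _ ≤ ∑ k : Fin 4 → Fin L,
        m * (absSumPoly (fun j => meanSgn fun p => a j p (k j)) + η) :=
      Finset.sum_le_sum fun k _ => hω fun j p => a j p (k j)
    _ = (L : ℝ) ^ 3
        * (m * L * (absSumPoly (fun j => (∑ l, meanSgn fun p => a j p l) / L) + η)) := by
      rw [← Finset.mul_sum, Finset.sum_add_distrib, h1]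
      simp
      ring

lemma card_filter_ne {α V : Type} (S : Finset α) (f g : α → V) (z : V → Bool) :
    ((S.filter fun e => z (f e) ≠ z (g e)).card : ℝ)
      = ∑ e ∈ S, (1 - sgn (z (f e)) * sgn (z (g e))) / 2 := by
  rw [Finset.card_filter]
  push_cast
  refine Finset.sum_congr rfl fun e _ => ?_
  cases z (f e) <;> cases z (g e) <;> norm_num [sgn]

lemma abs_meanSgn_le {A : Type} [Fintype A] (b : A → Bool) : |meanSgn b| ≤ 1 := by
  rw [meanSgn, abs_div, Nat.abs_cast]
  refine div_le_one_of_le₀ ((Finset.abs_sum_le_sum_abs _ _).trans ?_) (by positivity)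
  simp [abs_sgn]

lemma abs_sum_literals_le {z : Vtx N L m D → Bool} (hz : ∑ v, sgn (z v) = 0) :
    |∑ p : (Fin 4 × Fin N × Bool) × Fin L, sgn (z (Sum.inl p))| ≤ 2 * (m + D) := by
  rw [Fintype.sum_sum_type] at hz
  rw [eq_neg_of_add_eq_zero_left hz, abs_neg]
  refine (Finset.abs_sum_le_sum_abs _ _).trans ?_
  simp only [abs_sgn]
  simp
  linarith

/-- Soundness: when the constraints have small discrepancy, a bisection cuts few of the
constraint edges. -/
lemma card_cut_constraintEdges_le {ω : Fin m → Fin 4 → Fin N × Bool} {η s : ℝ} (hN : 0 < N)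
    (hL : 0 < L)
    (hω : ∀ b : Fin 4 → Fin N × Bool → Bool, ∑ C, |∑ j, sgn (b j (ω C j))|
      ≤ m * (absSumPoly (fun j => meanSgn (b j)) + η))
    (hs : (m + D : ℝ) ≤ s * (N * L)) {z : Vtx N L m D → Bool} (hz : ∑ v, sgn (z v) = 0) :
    (((constraintEdges D L ω).filter fun e => z e.1 ≠ z e.2).card : ℝ)
      ≤ m * L * (11 / 4 + s ^ 2 / 8 + η / 2) := by
  have hN' : (0 : ℝ) < N := by exact_mod_cast hN
  have hL' : (0 : ℝ) < L := by exact_mod_cast hL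
  set a : Fin 4 → Fin N × Bool → Fin L → Bool := fun j p l => z (Sum.inl ((j, p), l)) with ha
  set τ : Fin 4 → ℝ := fun j => (∑ l, meanSgn fun p => a j p l) / L with hτ
  have hτ1 : ∀ j, |τ j| ≤ 1 := by
    intro j
    simp only [hτ, abs_div, Nat.abs_cast]
    refine div_le_one_of_le₀ ((Finset.abs_sum_le_sum_abs _ _).trans ?_) (by positivity)
    refine (Finset.sum_le_sum fun l _ => abs_meanSgn_le fun p => a j p l).trans ?_
    simp
  have hτsum : ∑ j, τ j
      = (∑ p : (Fin 4 × Fin N × Bool) × Fin L, sgn (z (Sum.inl p))) / (2 * (N * L)) := by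
    rw [Fintype.sum_prod_type, Fintype.sum_prod_type, Finset.sum_div]
    refine Finset.sum_congr rfl fun j _ => ?_
    simp only [hτ, meanSgn, ← Finset.sum_div, div_div]
    rw [Finset.sum_comm]
    congr 1
    simp
    ring
  have hτs : |∑ j, τ j| ≤ s := by
    rw [hτsum, abs_div, abs_of_pos (by positivity : (0 : ℝ) < 2 * (N * L)),
      div_le_iff₀ (by positivity)]
    linarith [abs_sum_literals_le hz]
  have hsq : (∑ j, τ j) ^ 2 ≤ s ^ 2 := by
    rw [← sq_abs]
    exact pow_le_pow_left₀ (abs_nonneg _) hτs 2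
  have h1 := sum_abs_copies_le hL hω a
  have h2 := absSumPoly_le hτ1
  have h3 : ∑ C, |∑ j, ∑ l, sgn (a j (ω C j) l)| ≤ m * L * (3 / 2 + s ^ 2 / 4 + η) :=
    h1.trans (mul_le_mul_of_nonneg_left (by linarith) (by positivity))
  rw [card_filter_ne, sum_constraintEdges]
  have h4 : ∀ C, ∑ j, ∑ l, (1 - sgn (z (Sum.inr (Sum.inl (C, true))))
      * sgn (z (Sum.inl ((j, ω C j), l)))) / 2
      ≤ 2 * L + |∑ j, ∑ l, sgn (a j (ω C j) l)| / 2 := by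
    intro C
    have h5 : ∑ j, ∑ l, (1 - sgn (z (Sum.inr (Sum.inl (C, true))))
        * sgn (z (Sum.inl ((j, ω C j), l)))) / 2
        = 2 * L - sgn (z (Sum.inr (Sum.inl (C, true)))) * (∑ j, ∑ l, sgn (a j (ω C j) l)) / 2 := by
      simp only [← Finset.sum_div, Finset.sum_sub_distrib, ← Finset.mul_sum, ha]
      simp
      ring
    rw [h5]
    have h6 := neg_abs_le (sgn (z (Sum.inr (Sum.inl (C, true)))) * ∑ j, ∑ l, sgn (a j (ω C j) l))
    rw [abs_mul, abs_sgn, one_mul] at h6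
    linarith
  calc _ ≤ ∑ C, (2 * L + |∑ j, ∑ l, sgn (a j (ω C j) l)| / 2) := Finset.sum_le_sum fun C _ => h4 C
    _ = 2 * L * m + (∑ C, |∑ j, ∑ l, sgn (a j (ω C j) l)|) / 2 := by
      rw [Finset.sum_add_distrib, ← Finset.sum_div]
      simp
      ring
    _ ≤ _ := by linarith

end Soundness

lemma sum_sgn_eq_zero_of_bisection {n : ℕ} {x : Fin n → Bool}
    (hx : 2 * (Finset.univ.filter fun v => x v = true).card = n) : ∑ v, sgn (x v) = 0 := by
  have h1 : ∀ v, sgn (x v) = 2 * (if x v = true then (1 : ℝ) else 0) - 1 := fun v => by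
    cases x v <;> norm_num [sgn]
  have h2 : (2 * (Finset.univ.filter fun v => x v = true).card : ℝ) = n := by exact_mod_cast hx
  simp only [h1, Finset.sum_sub_distrib, ← Finset.mul_sum, Finset.sum_boole]
  rw [h2]
  simp

/-- A graph on which the completeness and the soundness properties hold simultaneously. -/
lemma exists_gap_graph {c K M L N D t d n : ℕ} (hc : 0 < c) (hK : K = 2560 * c ^ 2)
    (hM : M = 8 * K * c) (hL : L + M = 3 * c * M) (hn : n = 8 * L * N + 2 * (K * N) + 2 * D)
    (hD : K * N ≤ D) (hD' : D ≤ K * N + 4 * L + 2 * K) (hNM : 4 * M + 1 ≤ N) (hNc : 8 * c ≤ N)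
    (ht : (t + 1) * (192 * K) ^ 2 ≤ N) (ht' : 20 < t) (hd : 25 * d < t) :
    ∃ G : Finset (Fin n × Fin n), (∀ e ∈ G, e.1 ≠ e.2) ∧
      (∃ E : PEpm n d,
        (∀ v : Fin n, E.satEq (MvPolynomial.X v ^ 2) 1) ∧
        E.satEq (∑ v : Fin n, MvPolynomial.X v) 0 ∧
        E.satEq (MvPolynomial.C (1 / (4 * (G.card : ℝ))) *
            ∑ e ∈ G, (MvPolynomial.X e.1 - MvPolynomial.X e.2) ^ 2)
          (3 / 4 - 1 / (4 * (c : ℝ)))) ∧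
      (∀ x : Fin n → Bool, 2 * (Finset.univ.filter fun v => x v = true).card = n →
        ((G.filter fun e => x e.1 ≠ x e.2).card : ℝ) / (G.card : ℝ)
          ≤ 11 / 16 + 1 / (4 * (c : ℝ))) := by
  have hKpos : 0 < K := by rw [hK]; positivity
  have hMpos : 0 < M := by rw [hM]; positivity
  have hNpos : 0 < N := by omega
  have hcM : c * M ≤ L := by nlinarith
  have hLpos : 0 < L := lt_of_lt_of_le (Nat.mul_pos hc hMpos) hcM
  have hc' : (0 : ℝ) < c := by exact_mod_cast hc
  have hc1 : (1 : ℝ) ≤ c := by exact_mod_cast hc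
  have hM' : (0 : ℝ) < M := by exact_mod_cast hMpos
  have hKN' : (0 : ℝ) < (K * N : ℕ) := by exact_mod_cast Nat.mul_pos hKpos hNpos
  have hLr : (L : ℝ) = (3 * c - 1) * M := by
    have : (L + M : ℝ) = 3 * c * M := by exact_mod_cast hL
    linarith
  obtain ⟨ω, hexp, hdisc⟩ := exists_expanding_instance (K := K) (N := N) (t := t + 1)
    (η := 1 / (2 * c)) hKpos hNpos ht (by positivity)
    (by rw [div_le_iff₀ (by positivity)]; linarith)
    (by rw [hK]; push_cast; field_simp; norm_num)
  have hpool : 4 * M * (K * N) ≤ (paddingPairs N L (K * N) D).card := by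
    rw [card_paddingPairs]
    have h1 : 4 * M + 1 ≤ D := hNM.trans ((Nat.le_mul_of_pos_left N hKpos).trans hD)
    calc 4 * M * (K * N) ≤ (D - 1) * D := Nat.mul_le_mul (by omega) hD
      _ = D * D - D := by rw [Nat.sub_mul, one_mul]
  obtain ⟨P, hP, hPcard⟩ := Finset.exists_subset_card_eq hpool
  have hcard : Fintype.card (Vtx N L (K * N) D) = n := by
    rw [hn]
    simp only [Vtx, Fintype.card_sum, Fintype.card_prod, Fintype.card_fin, Fintype.card_bool]
    ring
  set e : Vtx N L (K * N) D ≃ Fin n := Fintype.equivFinOfCardEq hcard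
  have hGcard : (((instanceEdges ω hP).map (e.prodCongr e).toEmbedding).card : ℝ)
      = 12 * c * M * (K * N : ℕ) := by
    rw [Finset.card_map, instanceEdges, Finset.card_disjUnion, card_constraintEdges, hPcard]
    push_cast
    rw [hLr]
    ring
  refine ⟨(instanceEdges ω hP).map (e.prodCongr e).toEmbedding, ?_, ?_, ?_⟩
  · intro p hp
    obtain ⟨q, hq, rfl⟩ := Finset.mem_map.mp hp
    suffices q.1 ≠ q.2 from fun h => this (e.injective h)
    rcases Finset.mem_disjUnion.mp hq with h | h
    · obtain ⟨k, _, rfl⟩ := Finset.mem_map.mp h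
      exact Sum.inr_ne_inl
    · exact (Finset.mem_offDiag.mp (hP h)).2.2
  · obtain ⟨E, h1, h2, h3⟩ := exists_pseudoexpectation e ω hexp hd ht' hP
      (1 / (4 * (((instanceEdges ω hP).map (e.prodCongr e).toEmbedding).card : ℝ)))
    refine ⟨E, h1, h2, ?_⟩
    convert h3 using 1
    rw [hGcard, hLr]
    field_simp
  · intro x hx
    have hz : ∑ v, sgn (x (e v)) = 0 :=
      (Equiv.sum_comp e fun v => sgn (x v)).trans (sum_sgn_eq_zero_of_bisection hx)
    have hs : ((K * N : ℕ) + D : ℝ) ≤ 1 / c * (N * L) := by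
      rw [one_div, inv_mul_eq_div, le_div_iff₀ hc']
      have h1 : 16 * (c * K) ≤ L := by
        have : 8 * K * c ≤ c * M := by
          rw [← hM]
          exact Nat.le_mul_of_pos_left M hc
        nlinarith
      have h2 : (K * N + D) * c ≤ N * L := by
        have h3 : (K * N + D) * c ≤ (2 * (K * N) + 4 * L + 2 * K) * c :=
          Nat.mul_le_mul_right c (by omega)
        have h4 : 8 * c * L ≤ N * L := Nat.mul_le_mul_right L hNc
        have h5 : 16 * (c * K) * N ≤ L * N := Nat.mul_le_mul_right N h1
        have h6 : 1 * (c * K) ≤ N * (c * K) := Nat.mul_le_mul_right _ hNpos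
        nlinarith
      exact_mod_cast h2
    have h1 := card_cut_constraintEdges_le hNpos hLpos hdisc hs (z := fun v => x (e v)) hz
    have h2 : ((instanceEdges ω hP).map (e.prodCongr e).toEmbedding |>.filter
        fun p => x p.1 ≠ x p.2).card
        ≤ ((constraintEdges D L ω).filter fun p => x (e p.1) ≠ x (e p.2)).card
          + 4 * M * (K * N) := by
      rw [Finset.filter_map, Finset.card_map, instanceEdges, Finset.filter_disjUnion,
        Finset.card_disjUnion, ← hPcard]
      exact Nat.add_le_add_left (Finset.card_filter_le _ _) _
    have h3 : (((instanceEdges ω hP).map (e.prodCongr e).toEmbedding |>.filter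
        fun p => x p.1 ≠ x p.2).card : ℝ)
        ≤ (((constraintEdges D L ω).filter fun p => x (e p.1) ≠ x (e p.2)).card : ℝ)
          + 4 * M * (K * N : ℕ) := by
      exact_mod_cast h2
    rw [hGcard, div_le_iff₀ (by positivity)]
    refine (h3.trans (add_le_add_left h1 _)).trans ?_
    have h4 : (1 / (c : ℝ)) ^ 2 / 8 + 1 / (2 * (c : ℝ)) / 2 ≤ 3 / (8 * c) := by
      rw [div_add_div _ _ (by norm_num) (by norm_num), div_le_div_iff₀ (by norm_num) (by positivity)]
      field_simp
      nlinarith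
    have h5 : (3 * (c : ℝ) - 1) * (11 / 4 + 3 / (8 * c)) + 4
        ≤ (11 / 16 + 1 / (4 * (c : ℝ))) * (12 * c) := by
      have h6 : (3 * (c : ℝ) - 1) * (11 / 4 + 3 / (8 * c))
          = 33 / 4 * c - 13 / 8 - 3 / (8 * c) := by
        field_simp
        ring
      have h7 : (11 / 16 + 1 / (4 * (c : ℝ))) * (12 * c) = 33 / 4 * c + 3 := by
        field_simp
        ring
      have h8 : 0 ≤ 3 / (8 * (c : ℝ)) := by positivity
      rw [h6, h7]
      linarith
    calc _ ≤ (K * N : ℕ) * (L : ℝ) * (11 / 4 + 3 / (8 * c)) + 4 * M * (K * N : ℕ) := by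
          refine add_le_add_left (mul_le_mul_of_nonneg_left ?_ (by positivity)) _
          linarith
      _ = (K * N : ℕ) * M * ((3 * (c : ℝ) - 1) * (11 / 4 + 3 / (8 * c)) + 4) := by
          rw [hLr]
          ring
      _ ≤ (K * N : ℕ) * M * ((11 / 16 + 1 / (4 * (c : ℝ))) * (12 * c)) :=
          mul_le_mul_of_nonneg_left h5 (by positivity)
      _ = _ := by ring

/-- a degree-Ω(n) SOS lower bound for Max-Bisection with approximation factor
11/12 + ε, for ε = 1/(4c), c an even positive integer. -/
theorem stmt11 :
    ∀ c : ℕ, 0 < c → Even c →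
      ∃ cdeg : ℝ, 0 < cdeg ∧
        ∀ δ : ℝ, 0 < δ →
          ∃ N : ℕ, ∀ n : ℕ, N ≤ n → 2 ∣ n →
            ∃ (Ω : Type) (inst : Fintype Ω) (G : Ω → Finset (Fin n × Fin n)),
              (∀ ω : Ω, ∀ e ∈ G ω, e.1 ≠ e.2) ∧
              1 - δ ≤
                @uprob Ω inst (fun ω : Ω =>
                  -- completeness: a degree-Ω(n) pseudoexpectation cutting a 3/4 - 1/(4c)
                  -- fraction of the edges
                  (∃ E : PEpm n ⌊cdeg * (n : ℝ)⌋₊,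
                    (∀ v : Fin n, E.satEq (MvPolynomial.X v ^ 2) 1) ∧
                    E.satEq (∑ v : Fin n, MvPolynomial.X v) 0 ∧
                    E.satEq
                      (MvPolynomial.C (1 / (4 * ((G ω).card : ℝ))) *
                        ∑ e ∈ G ω, (MvPolynomial.X e.1 - MvPolynomial.X e.2) ^ 2)
                      (3 / 4 - 1 / (4 * (c : ℝ)))) ∧
                  -- soundness: every genuine bisection cuts at most a 11/16 + 1/(4c)
                  -- fraction of the edges
                  (∀ x : Fin n → Bool,
                    2 * (Finset.univ.filter fun v => x v = true).card = n →
                    (((G ω).filter fun e => x e.1 ≠ x e.2).card : ℝ) / ((G ω).card : ℝ)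
                      ≤ 11 / 16 + 1 / (4 * (c : ℝ)))) := by
  intro c hc _
  obtain ⟨K, hK⟩ : ∃ K, K = 2560 * c ^ 2 := ⟨_, rfl⟩
  obtain ⟨M, hM⟩ : ∃ M, M = 8 * K * c := ⟨_, rfl⟩
  obtain ⟨L, hL⟩ : ∃ L, L + M = 3 * c * M :=
    ⟨3 * c * M - M, Nat.sub_add_cancel (Nat.le_mul_of_pos_left M (by omega))⟩
  obtain ⟨W, hW⟩ : ∃ W, W = (192 * K) ^ 2 := ⟨_, rfl⟩
  have hKpos : 0 < K := by rw [hK]; positivity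
  have hWpos : 0 < W := by rw [hW]; positivity
  have hBpos : 0 < 8 * L + 4 * K := by omega
  refine ⟨1 / ((100 * W * (8 * L + 4 * K) : ℕ) : ℝ), by positivity, fun δ hδ => ?_⟩
  refine ⟨(200 * W + 8 * c + 4 * M + 1) * (8 * L + 4 * K), fun n hn h2n => ?_⟩
  obtain ⟨n', rfl⟩ := h2n
  obtain ⟨N, hN⟩ : ∃ N, N = n' / (4 * L + 2 * K) := ⟨_, rfl⟩
  have hlow : N * (4 * L + 2 * K) ≤ n' := by rw [hN]; exact Nat.div_mul_le_self _ _
  have hupp : n' < (N + 1) * (4 * L + 2 * K) := by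
    rw [← Nat.div_lt_iff_lt_mul (by omega), ← hN]
    exact Nat.lt_succ_self N
  have hNbig : 200 * W + 8 * c + 4 * M + 1 ≤ N := by
    rw [hN, Nat.le_div_iff_mul_le (by omega)]
    nlinarith
  have hmul : N * (4 * L + 2 * K) = 4 * L * N + 2 * (K * N) := by ring
  rw [add_mul, one_mul, hmul] at hupp
  rw [hmul] at hlow
  obtain ⟨D, hD⟩ : ∃ D, n' = 4 * L * N + K * N + D :=
    ⟨n' - (4 * L * N + K * N), by omega⟩
  obtain ⟨t, ht⟩ : ∃ t, t + 1 = N / W :=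
    ⟨N / W - 1, Nat.sub_add_cancel ((Nat.le_div_iff_mul_le hWpos).2 (by omega))⟩
  have htW : (t + 1) * W ≤ N := by rw [ht]; exact Nat.div_mul_le_self _ _
  have ht200 : 200 ≤ t + 1 := by
    rw [ht, Nat.le_div_iff_mul_le hWpos]
    omega
  have hd : 50 * ⌊1 / ((100 * W * (8 * L + 4 * K) : ℕ) : ℝ) * ((2 * n' : ℕ) : ℝ)⌋₊ ≤ t + 1 := by
    rw [one_div, inv_mul_eq_div, Nat.floor_div_eq_div, ht, Nat.le_div_iff_mul_le hWpos]
    have h1 := Nat.div_mul_le_self (2 * n') (100 * W * (8 * L + 4 * K))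
    set q := 2 * n' / (100 * W * (8 * L + 4 * K))
    have h2 : 2 * n' ≤ 2 * N * (8 * L + 4 * K) := by
      calc 2 * n' ≤ 2 * (4 * L * N + 2 * (K * N) + (4 * L + 2 * K)) := Nat.mul_le_mul_left 2 hupp.le
        _ = (N + 1) * (8 * L + 4 * K) := by ring
        _ ≤ _ := Nat.mul_le_mul_right _ (by omega)
    have h3 : (q * (100 * W)) * (8 * L + 4 * K) ≤ 2 * N * (8 * L + 4 * K) := by
      calc _ = q * (100 * W * (8 * L + 4 * K)) := by ring
        _ ≤ _ := h1.trans h2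
    have h4 := Nat.le_of_mul_le_mul_right h3 hBpos
    have h5 : q * (100 * W) = 2 * (50 * q * W) := by ring
    omega
  obtain ⟨G, hloop, hcompl, hsound⟩ := exists_gap_graph (t := t) (N := N) (D := D) hc hK hM hL
    (show 2 * n' = 8 * L * N + 2 * (K * N) + 2 * D by rw [hD]; ring) (by omega)
    (by omega) (by omega) (by omega) (hW ▸ htW) (by omega)
    (show 25 * ⌊1 / ((100 * W * (8 * L + 4 * K) : ℕ) : ℝ) * ((2 * n' : ℕ) : ℝ)⌋₊ < t by omega)
  refine ⟨Unit, inferInstance, fun _ => G, fun _ => hloop, ?_⟩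
  have h1 : ∀ p : Unit → Prop, p () → uprob p = 1 := fun p hp => by
    have : ∀ u, p u := fun _ => hp
    simp [uprob, this]
  rw [h1 _ ⟨hcompl, hsound⟩]
  linarith
end
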